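/- arXiv:2203.02971 — 7 statements merged into one kernel-verified Lean document; each statement's English description precedes it below -/
import Mathlib

section
/- Let G be a finite group whose derived (commutator) subgroup has square-free order, and let X be a subset of G \ {1} with X = X⁻¹ and |X| ≥ 4. Then the Cayley graph Cay(G,X) admits a nowhere-zero 3-flow. -/
/-- A nowhere-zero 3-flow on a finite simple graph: an antisymmetric integer-valued
function on ordered pairs of vertices, vanishing on non-adjacent pairs, with
`0 < |f u v| < 3` on adjacent pairs, and with zero net flow at every vertex. -/
def HasNowhereZero3Flow {V : Type*} [Fintype V] (G : SimpleGraph V) : Prop :=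
  ∃ f : V → V → ℤ,
    (∀ u v, f u v = - f v u) ∧
    (∀ u v, ¬ G.Adj u v → f u v = 0) ∧
    (∀ u v, G.Adj u v → 0 < |f u v| ∧ |f u v| < 3) ∧
    ∀ u, ∑ v, f u v = 0

/-- The Cayley graph of a group with connection set `X`: `g` and `h` are adjacent
iff `g⁻¹ * h ∈ X` (for `X` inverse-closed with `1 ∉ X` this is symmetric and loopless). -/
def cayleyGraph {G : Type*} [Group G] (X : Set G) : SimpleGraph G :=
  SimpleGraph.fromRel (fun g h => g⁻¹ * h ∈ X)


/-! ### From flows modulo three to integer flows -/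

section IntegerFlow

variable {V : Type*}

/-- Simple directed paths from `u` along the positive arcs of `f`, recorded by their vertex set
and endpoint. -/
inductive PositivePath [DecidableEq V] (f : V → V → ℤ) (u : V) : Finset V → V → Prop
  | nil : PositivePath f u {u} u
  | snoc {S : Finset V} {a b : V} : PositivePath f u S a → b ∉ S → 0 < f a b →
      PositivePath f u (insert b S) b

theorem PositivePath.exists_of_mem [DecidableEq V] {f : V → V → ℤ} {u a : V} {S : Finset V}
    (h : PositivePath f u S a) : ∀ b ∈ S, ∃ S', PositivePath f u S' b := by
  induction h with
  | nil =>
    intro b hb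
    obtain rfl := Finset.mem_singleton.mp hb
    exact ⟨_, .nil⟩
  | snoc h hb hf ih =>
    intro c hc
    rcases Finset.mem_insert.mp hc with rfl | hc
    · exact ⟨_, .snoc h hb hf⟩
    · exact ih c hc

theorem PositivePath.end_mem [DecidableEq V] {f : V → V → ℤ} {u a : V} {S : Finset V}
    (h : PositivePath f u S a) : a ∈ S := by
  cases h <;> simp

/-- Antisymmetric integer lifts of `φ` with values of absolute value at most two. -/
def IsLift (φ : V → V → ZMod 3) (f : V → V → ℤ) : Prop :=
  ∀ u v, f u v = - f v u ∧ (f u v : ZMod 3) = φ u v ∧ |f u v| < 3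

theorem exists_isLift (φ : V → V → ZMod 3) (hφ : ∀ u v, φ u v = - φ v u) :
    ∃ f, IsLift φ f := by
  refine ⟨fun u v => (φ u v).valMinAbs, fun u v => ?_⟩
  have key : ∀ a b : ZMod 3, a = -b → a.valMinAbs = - b.valMinAbs ∧
      ((a.valMinAbs : ℤ) : ZMod 3) = a ∧ |a.valMinAbs| < 3 := by decide
  exact key _ _ (hφ u v)

theorem IsLift.augment [Fintype V] [DecidableEq V] {φ : V → V → ZMod 3} {f : V → V → ℤ} (hf : IsLift φ f) {u a : V}
    {S : Finset V} (h : PositivePath f u S a) :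
    ∃ f', IsLift φ f' ∧ (∀ v w, v ∉ S ∨ w ∉ S → f' v w = f v w) ∧
      ∀ v, ∑ w, f' v w = ∑ w, f v w - (if v = u then 3 else 0) + (if v = a then 3 else 0) := by
  induction h with
  | nil => exact ⟨f, hf, fun _ _ _ => rfl, fun v => by ring⟩
  | @snoc S a b h hb hpos ih =>
    obtain ⟨g, hg, hgS, hsum⟩ := ih
    have ha : a ∈ S := h.end_mem
    have hab : a ≠ b := fun e => hb (e ▸ ha)
    have hgab : g a b = f a b := hgS a b (Or.inr hb)
    refine ⟨fun v w => g v w - (if v = a ∧ w = b then 3 else 0) +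
      (if v = b ∧ w = a then 3 else 0), fun v w => ?_, fun v w hvw => ?_, fun v => ?_⟩
    · obtain ⟨h1, h2, h3⟩ := hg v w
      have h3' : (3 : ZMod 3) = 0 := by decide
      by_cases c1 : v = a ∧ w = b
      · obtain ⟨rfl, rfl⟩ := c1
        have h4 := abs_lt.mp h3
        refine ⟨?_, ?_, ?_⟩
        · simp [hab, hab.symm]; linarith
        · simp [hab, h2, h3']
        · simp only [hab, hab.symm, and_self, if_true, if_false]
          rw [abs_lt]; constructor <;> omega
      · by_cases c2 : v = b ∧ w = a
        · obtain ⟨rfl, rfl⟩ := c2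
          have h4 := abs_lt.mp h3
          refine ⟨?_, ?_, ?_⟩
          · simp [hab, hab.symm]; linarith
          · simp [hab.symm, h2, h3']
          · simp only [hab, hab.symm, and_self, if_true, if_false]
            rw [abs_lt]; constructor <;> omega
        · have c1' : ¬ (w = b ∧ v = a) := fun c => c1 c.symm
          have c2' : ¬ (w = a ∧ v = b) := fun c => c2 c.symm
          simp only [c1, c2, c1', c2', if_false]
          simpa using ⟨h1, h2, h3⟩
    · have hb' : b ∈ insert b S := Finset.mem_insert_self _ _
      have ha' : a ∈ insert b S := Finset.mem_insert_of_mem ha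
      have c1 : ¬ (v = a ∧ w = b) := by rintro ⟨rfl, rfl⟩; tauto
      have c2 : ¬ (v = b ∧ w = a) := by rintro ⟨rfl, rfl⟩; tauto
      simp only [c1, c2, if_false, sub_zero, add_zero]
      apply hgS
      simp only [Finset.mem_insert, not_or] at hvw
      tauto
    · rw [Finset.sum_add_distrib, Finset.sum_sub_distrib, hsum]
      have e (c d : V) : ∑ w, (if v = c ∧ w = d then (3 : ℤ) else 0) = if v = c then 3 else 0 := by
        by_cases hv : v = c <;> simp [hv]
      rw [e, e]
      ring

theorem IsLift.exists_balanced [Fintype V] {φ : V → V → ZMod 3} (hsum : ∀ u, ∑ v, φ u v = 0) :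
    ∀ (n : ℕ) (f : V → V → ℤ), IsLift φ f → (∑ u, |∑ v, f u v|).toNat ≤ n →
      ∃ f, IsLift φ f ∧ ∀ u, ∑ v, f u v = 0 := by
  classical
  intro n
  induction n using Nat.strong_induction_on with
  | _ n ih =>
  intro f hf hn
  by_cases h0 : ∀ u, ∑ v, f u v = 0
  · exact ⟨f, hf, h0⟩
  have htot : ∀ R : Finset V, ∑ u ∈ R, ∑ v ∈ R, f u v = 0 := by
    intro R
    have : ∑ u ∈ R, ∑ v ∈ R, f u v = - ∑ u ∈ R, ∑ v ∈ R, f u v := by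
      conv_lhs => rw [Finset.sum_comm]
      rw [← Finset.sum_neg_distrib]
      refine Finset.sum_congr rfl fun u _ => ?_
      rw [← Finset.sum_neg_distrib]
      exact Finset.sum_congr rfl fun v _ => (hf v u).1
    linarith
  have hdvd : ∀ u, (3 : ℤ) ∣ ∑ v, f u v := by
    intro u
    rw [← Nat.cast_ofNat, ← ZMod.intCast_zmod_eq_zero_iff_dvd, Int.cast_sum, ← hsum u]
    exact Finset.sum_congr rfl fun v _ => (hf u v).2.1
  obtain ⟨u, hu⟩ : ∃ u, 0 < ∑ v, f u v := by
    by_contra! hneg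
    apply h0
    have := (Finset.sum_eq_zero_iff_of_nonpos (fun i (_ : i ∈ Finset.univ) => hneg i)).mp
      (htot Finset.univ)
    exact fun u => this u (Finset.mem_univ u)
  let R : Finset V := Finset.univ.filter fun a => ∃ S, PositivePath f u S a
  have huR : u ∈ R := by simpa [R] using ⟨_, PositivePath.nil⟩
  have hout : ∀ a ∈ R, ∀ b ∉ R, f a b ≤ 0 := by
    intro a ha b hb
    by_contra! hpos
    obtain ⟨S, hS⟩ : ∃ S, PositivePath f u S a := by simpa [R] using ha
    apply hb
    by_cases hbS : b ∈ S
    · simpa [R] using hS.exists_of_mem b hbS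
    · simpa [R] using ⟨_, PositivePath.snoc hS hbS hpos⟩
  obtain ⟨v, hvR, hv⟩ : ∃ v ∈ R, ∑ w, f v w < 0 := by
    by_contra! hnn
    have h1 : ∑ a ∈ R, ∑ w, f a w ≤ 0 := by
      have : ∀ a ∈ R, ∑ w, f a w ≤ ∑ w ∈ R, f a w := by
        intro a ha
        rw [← Finset.sum_add_sum_compl R]
        have : ∑ w ∈ Rᶜ, f a w ≤ 0 :=
          Finset.sum_nonpos fun w hw => hout a ha w (Finset.mem_compl.mp hw)
        linarith
      exact (Finset.sum_le_sum this).trans (htot R).le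
    have h2 : 0 < ∑ a ∈ R, ∑ w, f a w := Finset.sum_pos' hnn ⟨u, huR, hu⟩
    linarith
  obtain ⟨S, hS⟩ : ∃ S, PositivePath f u S v := by simpa [R] using hvR
  obtain ⟨g, hg, -, hgsum⟩ := hf.augment hS
  have huv : u ≠ v := by rintro rfl; omega
  have hlt : ∑ a, |∑ w, g a w| < ∑ a, |∑ w, f a w| := by
    apply Finset.sum_lt_sum
    · intro a _
      rw [hgsum]
      by_cases h1 : a = u
      · subst h1
        have := hdvd a
        simp only [huv, if_true, if_false, add_zero]
        rw [abs_le]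
        rw [abs_of_pos hu]
        constructor <;> omega
      · by_cases h2 : a = v
        · subst h2
          have := hdvd a
          simp only [h1, if_true, if_false, sub_zero]
          rw [abs_le, abs_of_neg hv]
          constructor <;> omega
        · simp [h1, h2]
    · refine ⟨u, Finset.mem_univ _, ?_⟩
      have := hdvd u
      rw [hgsum]
      simp only [huv, if_true, if_false, add_zero]
      rw [abs_lt, abs_of_pos hu]
      constructor <;> omega
  have hnn : 0 ≤ ∑ a, |∑ w, g a w| := Finset.sum_nonneg fun _ _ => abs_nonneg _
  exact ih _ (by omega) g hg le_rfl

/-- A nowhere-zero flow with values in `ZMod 3` yields a nowhere-zero 3-flow. -/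
theorem hasNowhereZero3Flow_of_zmod [Fintype V] (Γ : SimpleGraph V) (φ : V → V → ZMod 3)
    (hanti : ∀ u v, φ u v = - φ v u) (hadj : ∀ u v, Γ.Adj u v ↔ φ u v ≠ 0)
    (hsum : ∀ u, ∑ v, φ u v = 0) : HasNowhereZero3Flow Γ := by
  obtain ⟨f₀, hf₀⟩ := exists_isLift φ hanti
  obtain ⟨f, hf, hbal⟩ := IsLift.exists_balanced hsum _ f₀ hf₀ le_rfl
  refine ⟨f, fun u v => (hf u v).1, fun u v h => ?_, fun u v h => ⟨?_, (hf u v).2.2⟩, hbal⟩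
  · rw [hadj, not_not, ← (hf u v).2.1, ZMod.intCast_zmod_eq_zero_iff_dvd] at h
    have := abs_lt.mp (hf u v).2.2
    norm_num at h
    omega
  · rw [hadj, ← (hf u v).2.1] at h
    exact abs_pos.mpr fun e => h (by simp [e])

end IntegerFlow

/-! ### Flows on Cayley graphs that are lifted from a homomorphic image -/

section CayleyFlow

variable {G H : Type*} [Group G] [Group H]

/-- A nowhere-zero flow modulo three on the Cayley graph of `G` with connection set `X` whose value
on the arc from `g` to `g * x` depends only on `φ g` and `x`. -/
def HasCayleyFlow (φ : G →* H) (X : Finset G) : Prop :=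
  ∃ s : H → G → ZMod 3, (∀ h, ∀ x ∈ X, s h x ≠ 0) ∧
    (∀ h, ∀ x ∈ X, s (h * φ x) x⁻¹ = - s h x) ∧ ∀ h, ∑ x ∈ X, s h x = 0

theorem HasCayleyFlow.toId {φ : G →* H} {X : Finset G} (h : HasCayleyFlow φ X) :
    HasCayleyFlow (MonoidHom.id G) X := by
  obtain ⟨s, h0, h1, h2⟩ := h
  refine ⟨fun g x => s (φ g) x, fun g => h0 _, fun g x hx => ?_, fun g => h2 _⟩
  simpa using h1 (φ g) x hx

theorem HasCayleyFlow.disjoint_union [DecidableEq G] {φ : G →* H} {X Y : Finset G}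
    (hX : HasCayleyFlow φ X) (hY : HasCayleyFlow φ Y) (hXY : Disjoint X Y)
    (hXinv : ∀ x ∈ X, x⁻¹ ∈ X) (hYinv : ∀ x ∈ Y, x⁻¹ ∈ Y) : HasCayleyFlow φ (X ∪ Y) := by
  obtain ⟨s, s0, s1, s2⟩ := hX
  obtain ⟨t, t0, t1, t2⟩ := hY
  have hY' : ∀ x ∈ Y, x ∉ X := fun x hx => Finset.disjoint_right.mp hXY hx
  refine ⟨fun h x => if x ∈ X then s h x else t h x, fun h x hx => ?_, fun h x hx => ?_,
    fun h => ?_⟩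
  · rcases Finset.mem_union.mp hx with hx | hx
    · simpa [hx] using s0 h x hx
    · simpa [hY' x hx] using t0 h x hx
  · rcases Finset.mem_union.mp hx with hx | hx
    · simpa [hx, hXinv x hx] using s1 h x hx
    · simpa [hY' x hx, hY' _ (hYinv x hx)] using t1 h x hx
  · rw [Finset.sum_union hXY, Finset.sum_congr rfl fun x hx => if_pos hx,
      Finset.sum_congr rfl fun x hx => if_neg (hY' x hx), s2, t2, add_zero]

theorem HasCayleyFlow.hasNowhereZero3Flow [Fintype G] {X : Finset G}
    (h : HasCayleyFlow (MonoidHom.id G) X) (h1 : (1 : G) ∉ X) (hinv : ∀ x ∈ X, x⁻¹ ∈ X) :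
    HasNowhereZero3Flow (cayleyGraph (X : Set G)) := by
  classical
  obtain ⟨s, s0, s1, s2⟩ := h
  have hswap : ∀ u v : G, u⁻¹ * v ∈ X → v⁻¹ * u ∈ X := fun u v h => by
    simpa using hinv _ h
  refine hasNowhereZero3Flow_of_zmod _
    (fun u v => if u⁻¹ * v ∈ X then s u (u⁻¹ * v) else 0) (fun u v => ?_) (fun u v => ?_) fun u => ?_
  · by_cases huv : u⁻¹ * v ∈ X
    · have := s1 u _ huv
      simp only [MonoidHom.id_apply, mul_inv_cancel_left, mul_inv_rev, inv_inv] at this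
      simp [huv, hswap _ _ huv, this]
    · have hvu : v⁻¹ * u ∉ X := fun h => huv (hswap v u h)
      simp [huv, hvu]
  · rw [cayleyGraph, SimpleGraph.fromRel_adj]
    simp only [Finset.mem_coe]
    by_cases huv : u⁻¹ * v ∈ X
    · have : u ≠ v := by rintro rfl; simp [h1] at huv
      simpa [huv, this] using s0 u _ huv
    · have hvu : v⁻¹ * u ∉ X := fun h => huv (hswap v u h)
      simp [huv, hvu]
  · rw [← Equiv.sum_comp (Equiv.mulLeft u)]
    simpa [Finset.sum_ite_mem] using s2 u

theorem HasCayleyFlow.of_subgroup {S : Subgroup G} {X : Finset S}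
    (h : HasCayleyFlow (MonoidHom.id S) X) :
    HasCayleyFlow (MonoidHom.id G) (X.map (Function.Embedding.subtype _)) := by
  classical
  obtain ⟨s, s0, s1, s2⟩ := h
  let r : G → G := fun g => (g : G ⧸ S).out
  have hr : ∀ g, (r g)⁻¹ * g ∈ S := fun g =>
    QuotientGroup.eq.mp (Quotient.out_eq (g : G ⧸ S))
  have hrx : ∀ g, ∀ x ∈ S, r (g * x) = r g := fun g x hx => by
    simp [r, QuotientGroup.mk_mul_of_mem g hx]
  refine ⟨fun g x => if hx : x ∈ S then s ⟨(r g)⁻¹ * g, hr g⟩ ⟨x, hx⟩ else 0, ?_, ?_, ?_⟩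
  · intro g x hx
    obtain ⟨y, hy, rfl⟩ := Finset.mem_map.mp hx
    simpa using s0 _ y hy
  · intro g x hx
    obtain ⟨y, hy, he⟩ := Finset.mem_map.mp hx
    obtain rfl : (y : G) = x := he
    have := s1 ⟨(r g)⁻¹ * g, hr g⟩ y hy
    have hy' : (y : G)⁻¹ ∈ S := S.inv_mem y.2
    simp only [hy', y.2, dif_pos]
    convert this using 2
    · ext
      simp [hrx g y y.2, mul_assoc]
    · rfl
  · intro g
    rw [Finset.sum_map]
    simpa using s2 _

/-- A function on `H` invariant under right multiplication by `B` which changes sign under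
right multiplication by `t`. -/
theorem exists_sign (B : Subgroup H) (t : H) (ht : t ∉ B) (ht2 : t * t ∈ B)
    (hB : ∀ b ∈ B, t⁻¹ * b * t ∈ B) :
    ∃ c : H → (ZMod 3)ˣ, (∀ h, ∀ b ∈ B, c (h * b) = c h) ∧ ∀ h, c (h * t) = - c h := by
  classical
  let _ : LinearOrder (H ⧸ B) := linearOrderOfSTO WellOrderingRel
  refine ⟨fun h => if (h : H ⧸ B) < (h * t : H) then 1 else -1, fun h b hb => ?_, fun h => ?_⟩
  · have h1 : ((h * b : H) : H ⧸ B) = h := QuotientGroup.mk_mul_of_mem h hb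
    have h2 : ((h * b * t : H) : H ⧸ B) = (h * t : H) := by
      rw [show h * b * t = h * t * (t⁻¹ * b * t) by group]
      exact QuotientGroup.mk_mul_of_mem _ (hB b hb)
    simp only [h1, h2]
  · have h1 : ((h * t * t : H) : H ⧸ B) = h := by
      rw [mul_assoc]
      exact QuotientGroup.mk_mul_of_mem h ht2
    have h2 : ((h * t : H) : H ⧸ B) ≠ h := fun e => by
      have := QuotientGroup.eq.mp e.symm
      exact ht (by simpa using this)
    simp only [h1]
    rcases lt_or_gt_of_ne h2 with h3 | h3
    · simp [h3, h3.not_gt]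
    · simp [h3, h3.not_gt]

theorem hasCayleyFlow_of_sign (φ : G →* H) (X : Finset G) (c : H → (ZMod 3)ˣ) (w : G → ZMod 3)
    (hX : ∀ x ∈ X, x⁻¹ = x) (hc : ∀ x ∈ X, ∀ h, c (h * φ x) = - c h) (hw : ∀ x ∈ X, w x ≠ 0)
    (hsum : ∑ x ∈ X, w x = 0) : HasCayleyFlow φ X := by
  refine ⟨fun h x => c h * w x, fun h x hx => ?_, fun h x hx => ?_, fun h => ?_⟩
  · exact mul_ne_zero (c h).ne_zero (hw x hx)
  · simp [hX x hx, hc x hx]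
  · rw [← Finset.mul_sum, hsum, mul_zero]

theorem eq_one_or_eq_of_mem_zpowers {u x : G} (hu : u * u = 1) (hx : x ∈ Subgroup.zpowers u) :
    x = 1 ∨ x = u := by
  obtain ⟨k, rfl⟩ := Subgroup.mem_zpowers_iff.mp hx
  obtain ⟨m, rfl | rfl⟩ := Int.even_or_odd' k
  · left; rw [zpow_mul]; norm_cast; rw [pow_two, hu, one_zpow]
  · right; rw [zpow_add, zpow_mul]; norm_cast; rw [pow_two, hu, one_zpow, one_mul, pow_one]

theorem hasCayleyFlow_pair_inv [DecidableEq G] {x : G} (hx : x⁻¹ ≠ x) :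
    HasCayleyFlow (MonoidHom.id G) {x, x⁻¹} := by
  refine ⟨fun _ y => if y = x then 1 else -1, fun _ y _ => ?_, fun _ y hy => ?_, fun _ => ?_⟩
  · by_cases hy : y = x <;> simp [hy]
  · simp only [Finset.mem_insert, Finset.mem_singleton] at hy
    rcases hy with rfl | rfl <;> simp [hx]
  · rw [Finset.sum_pair hx.symm]
    simp [hx]

theorem hasCayleyFlow_pair_involutions [DecidableEq G] {a b : G} (ha : a⁻¹ = a) (hb : b⁻¹ = b)
    (ha1 : a ≠ 1) (hb1 : b ≠ 1) (hab : a ≠ b) : HasCayleyFlow (MonoidHom.id G) {a, b} := by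
  have haa : a * a = 1 := by rw [← inv_eq_iff_mul_eq_one, ha]
  have hbb : b * b = 1 := by rw [← inv_eq_iff_mul_eq_one, hb]
  have hconj : a⁻¹ * (a * b) * a = (a * b)⁻¹ := by simp [hb, ha, ← mul_assoc, haa]
  have hmem : a ∉ Subgroup.zpowers (a * b) := by
    intro hmem
    have hcomm : a⁻¹ * (a * b) * a = a * b := by
      obtain ⟨k, hk⟩ := Subgroup.mem_zpowers_iff.mp hmem
      have : Commute a (a * b) := by
        conv_lhs => rw [← hk]
        exact (Commute.refl _).zpow_left k
      rw [mul_assoc, ← this.eq, inv_mul_cancel_left]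
    rcases eq_one_or_eq_of_mem_zpowers
      (by rw [← inv_eq_iff_mul_eq_one, ← hconj, hcomm]) hmem with h | h
    · exact ha1 h
    · exact hb1 (by simpa using h)
  have hnorm : ∀ u ∈ Subgroup.zpowers (a * b), a⁻¹ * u * a ∈ Subgroup.zpowers (a * b) := by
    intro u hu
    obtain ⟨k, rfl⟩ := Subgroup.mem_zpowers_iff.mp hu
    refine Subgroup.mem_zpowers_iff.mpr ⟨-k, ?_⟩
    have := conj_zpow (a := a⁻¹) (b := a * b) (i := k)
    rw [inv_inv, hconj] at this
    rw [← this, inv_zpow, zpow_neg]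
  obtain ⟨c, hc1, hc2⟩ := exists_sign _ a hmem (haa ▸ Subgroup.one_mem _) hnorm
  refine hasCayleyFlow_of_sign _ _ c (fun x => if x = a then 1 else -1) ?_ ?_ ?_ ?_
  · simp [ha, hb]
  · simp only [Finset.mem_insert, Finset.mem_singleton, MonoidHom.id_apply]
    rintro x (rfl | rfl) h
    · exact hc2 h
    · rw [← hc2 h, ← hc1 (h * a) _ (Subgroup.mem_zpowers _), ← mul_assoc, mul_assoc h a a, haa,
        mul_one]
  · intro x _
    by_cases hx : x = a <;> simp [hx]
  · rw [Finset.sum_pair hab]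
    simp [hab.symm]

end CayleyFlow

/-! ### Signings of darts -/

section DartSystem

variable {H ι : Type*} [Group H]

/-- Labelled generators `a i` of a group, closed under inversion and under conjugation by an
involution `ζ`, none of which lies in the subgroup generated by `ζ`. -/
structure DartSystem (H ι : Type*) [Group H] where
  /-- the involution -/
  ζ : H
  /-- the generators -/
  a : ι → H
  /-- inversion on labels -/
  inv : ι → ι
  /-- conjugation by the involution on labels -/
  conj : ι → ι
  inv_inv : ∀ i, inv (inv i) = i
  conj_conj : ∀ i, conj (conj i) = i
  conj_inv : ∀ i, conj (inv i) = inv (conj i)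
  a_inv : ∀ i, a (inv i) = (a i)⁻¹
  mul_a_conj : ∀ i, ζ * a (conj i) = a i * ζ
  mul_self : ζ * ζ = 1
  ne_one : ζ ≠ 1
  a_ne_one : ∀ i, a i ≠ 1
  a_ne : ∀ i, a i ≠ ζ
  closure_eq : Subgroup.closure (insert ζ (Set.range a)) = ⊤

namespace DartSystem

variable (D : DartSystem H ι)

/-- The cosets of the subgroup generated by the involution. -/
abbrev Vertex : Type _ := H ⧸ Subgroup.zpowers D.ζ

/-- The coset of a group element. -/
abbrev vtx (h : H) : D.Vertex := (h : H ⧸ Subgroup.zpowers D.ζ)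

theorem vtx_eq_vtx {g h : H} : D.vtx g = D.vtx h ↔ h = g ∨ h = g * D.ζ := by
  rw [QuotientGroup.eq]
  constructor
  · intro hm
    rcases eq_one_or_eq_of_mem_zpowers D.mul_self hm with e | e
    · exact Or.inl (inv_mul_eq_one.mp e).symm
    · exact Or.inr (inv_mul_eq_iff_eq_mul.mp e)
  · rintro (rfl | rfl) <;> simp

@[simp] theorem vtx_mul_ζ (h : H) : D.vtx (h * D.ζ) = D.vtx h :=
  (D.vtx_eq_vtx.mpr (Or.inr rfl)).symm

theorem vtx_mul_a_ne (h : H) (i : ι) : D.vtx h ≠ D.vtx (h * D.a i) := by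
  rw [Ne, D.vtx_eq_vtx]
  simp [D.a_ne_one i, D.a_ne i]

theorem mul_ζ_mul_a (h : H) (i : ι) : h * D.ζ * D.a (D.conj i) = h * D.a i * D.ζ := by
  rw [mul_assoc, D.mul_a_conj, mul_assoc]

theorem mul_ζ_mul_ζ (h : H) : h * D.ζ * D.ζ = h := by rw [mul_assoc, D.mul_self, mul_one]

/-- Signings of the darts that are reversed by dart inversion and by the involution. -/
def IsSigning (s : H → ι → (ZMod 3)ˣ) : Prop :=
  (∀ h i, s (h * D.a i) (D.inv i) = - s h i) ∧ ∀ h i, s (h * D.ζ) (D.conj i) = - s h i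

/-- The four darts equivalent to a given one. -/
def Orbit (h₀ : H) (i₀ : ι) (h : H) (i : ι) : Prop :=
  (h = h₀ ∧ i = i₀) ∨ (h = h₀ * D.a i₀ ∧ i = D.inv i₀) ∨ (h = h₀ * D.ζ ∧ i = D.conj i₀) ∨
    (h = h₀ * D.a i₀ * D.ζ ∧ i = D.conj (D.inv i₀))

theorem orbit_inv_of {h₀ : H} {i₀ : ι} {h : H} {i : ι} (ho : D.Orbit h₀ i₀ h i) :
    D.Orbit h₀ i₀ (h * D.a i) (D.inv i) := by
  rcases ho with ⟨rfl, rfl⟩ | ⟨rfl, rfl⟩ | ⟨rfl, rfl⟩ | ⟨rfl, rfl⟩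
  · exact Or.inr (Or.inl ⟨rfl, rfl⟩)
  · exact Or.inl ⟨by simp [D.a_inv], D.inv_inv _⟩
  · exact Or.inr (Or.inr (Or.inr ⟨D.mul_ζ_mul_a _ _, (D.conj_inv _).symm⟩))
  · refine Or.inr (Or.inr (Or.inl ⟨?_, by rw [← D.conj_inv, D.inv_inv]⟩))
    rw [D.mul_ζ_mul_a, D.a_inv, mul_inv_cancel_right]

theorem orbit_conj_of {h₀ : H} {i₀ : ι} {h : H} {i : ι} (ho : D.Orbit h₀ i₀ h i) :
    D.Orbit h₀ i₀ (h * D.ζ) (D.conj i) := by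
  rcases ho with ⟨rfl, rfl⟩ | ⟨rfl, rfl⟩ | ⟨rfl, rfl⟩ | ⟨rfl, rfl⟩
  · exact Or.inr (Or.inr (Or.inl ⟨rfl, rfl⟩))
  · exact Or.inr (Or.inr (Or.inr ⟨rfl, rfl⟩))
  · exact Or.inl ⟨D.mul_ζ_mul_ζ _, D.conj_conj _⟩
  · exact Or.inr (Or.inl ⟨D.mul_ζ_mul_ζ _, D.conj_conj _⟩)

theorem orbit_inv {h₀ : H} {i₀ : ι} {h : H} {i : ι} :
    D.Orbit h₀ i₀ (h * D.a i) (D.inv i) ↔ D.Orbit h₀ i₀ h i :=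
  ⟨fun ho => by simpa [D.a_inv, D.inv_inv] using D.orbit_inv_of ho, D.orbit_inv_of⟩

theorem orbit_conj {h₀ : H} {i₀ : ι} {h : H} {i : ι} :
    D.Orbit h₀ i₀ (h * D.ζ) (D.conj i) ↔ D.Orbit h₀ i₀ h i :=
  ⟨fun ho => by simpa [D.mul_ζ_mul_ζ, D.conj_conj] using D.orbit_conj_of ho, D.orbit_conj_of⟩

/-- The graph on the vertices defined by the darts. -/
def graph : SimpleGraph D.Vertex where
  Adj u v := ∃ h i, D.vtx h = u ∧ D.vtx (h * D.a i) = v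
  symm := ⟨by
    rintro _ _ ⟨h, i, rfl, rfl⟩
    exact ⟨h * D.a i, D.inv i, rfl, by simp [D.a_inv]⟩⟩
  loopless := ⟨by
    rintro _ ⟨h, i, rfl, e⟩
    exact D.vtx_mul_a_ne h i e.symm⟩

theorem graph_connected : D.graph.Connected := by
  have key : ∀ g ∈ Subgroup.closure (insert D.ζ (Set.range D.a)), ∀ h,
      D.graph.Reachable (D.vtx h) (D.vtx (h * g)) := by
    intro g hg
    induction hg using Subgroup.closure_induction with
    | mem x hx =>
      rcases hx with rfl | ⟨i, rfl⟩
      · simp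
      · exact fun h => SimpleGraph.Adj.reachable ⟨h, i, rfl, rfl⟩
    | one => simp
    | mul x y _ _ hx hy => exact fun h => (hx h).trans (by simpa [mul_assoc] using hy (h * x))
    | inv x _ hx => exact fun h => by simpa using (hx (h * x⁻¹)).symm
  rw [SimpleGraph.connected_iff]
  refine ⟨fun u v => ?_, ⟨D.vtx 1⟩⟩
  induction u using QuotientGroup.induction_on with | _ g
  induction v using QuotientGroup.induction_on with | _ h
  simpa using key (g⁻¹ * h) (D.closure_eq ▸ Subgroup.mem_top _) g

theorem exists_signing_const [Finite H] (v₀ : D.Vertex) :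
    ∃ s, D.IsSigning s ∧ ∀ h, D.vtx h = v₀ → ∀ i j, s h i = s h j := by
  classical
  cases nonempty_fintype D.Vertex
  obtain ⟨c, -, hc⟩ := exists_sign (⊥ : Subgroup H) D.ζ (by simpa using D.ne_one)
    (by simp [D.mul_self]) (by simp)
  let f : D.Vertex → ℕ := fun v => if v = v₀ then 0 else Fintype.equivFin _ v + 1
  have hf : Function.Injective f := by
    intro u v huv
    simp only [f] at huv
    split_ifs at huv with h1 h2
    · rw [h1, h2]
    · exact (Fintype.equivFin D.Vertex).injective (Fin.ext (by omega))
  refine ⟨fun h i => if f (D.vtx h) < f (D.vtx (h * D.a i)) then c h else - c (h * D.a i),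
    ⟨fun h i => ?_, fun h i => ?_⟩, fun h hh i j => ?_⟩
  · have hne : f (D.vtx h) ≠ f (D.vtx (h * D.a i)) := fun e => D.vtx_mul_a_ne h i (hf e)
    simp only [D.a_inv, mul_inv_cancel_right]
    rcases lt_or_gt_of_ne hne with h1 | h1
    · rw [if_neg h1.not_gt, if_pos h1]
    · rw [if_pos h1, if_neg h1.not_gt, neg_neg]
  · simp only [D.mul_ζ_mul_a, D.vtx_mul_ζ, hc]
    split_ifs <;> rfl
  · have (i : ι) : f (D.vtx h) < f (D.vtx (h * D.a i)) := by
      have h1 : f (D.vtx h) = 0 := by simp [f, hh]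
      have h2 : f (D.vtx h) ≠ f (D.vtx (h * D.a i)) := fun e => D.vtx_mul_a_ne h i (hf e)
      omega
    simp [this]

variable [Fintype ι]

/-- The product of the signs at a vertex. -/
def sgn (s : H → ι → (ZMod 3)ˣ) (h : H) : (ZMod 3)ˣ := ∏ i, s h i

theorem prod_conj (f : ι → (ZMod 3)ˣ) : ∏ i, f (D.conj i) = ∏ i, f i :=
  Equiv.prod_comp (Function.Involutive.toPerm D.conj D.conj_conj) f

theorem sgn_mul_ζ {s : H → ι → (ZMod 3)ˣ} (hs : D.IsSigning s) (hι : Even (Fintype.card ι))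
    (h : H) : sgn s (h * D.ζ) = sgn s h := by
  rw [sgn, ← D.prod_conj]
  simp_rw [hs.2]
  rw [Finset.prod_neg, Finset.card_univ, hι.neg_one_pow, one_mul, sgn]

theorem sgn_congr {s : H → ι → (ZMod 3)ˣ} (hs : D.IsSigning s) (hι : Even (Fintype.card ι))
    {g h : H} (hgh : D.vtx g = D.vtx h) : sgn s g = sgn s h := by
  rcases D.vtx_eq_vtx.mp hgh with rfl | rfl
  · rfl
  · exact (D.sgn_mul_ζ hs hι g).symm

/-- `Flips U u v` says that the sign products at `u` and `v` can be flipped by a change of signing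
within `U`. -/
def Flips (U : Set D.Vertex) (u v : D.Vertex) : Prop :=
  ∀ s, D.IsSigning s → ∃ s', D.IsSigning s' ∧ (∀ h, D.vtx h ∉ U → s' h = s h) ∧
    ∀ h, sgn s' h = sgn s h * ((if D.vtx h = u then -1 else 1) * (if D.vtx h = v then -1 else 1))

theorem Flips.refl {D : DartSystem H ι} (U : Set D.Vertex) (u : D.Vertex) : D.Flips U u u :=
  fun s hs => ⟨s, hs, fun _ _ => rfl, fun h => by split_ifs <;> simp⟩

theorem Flips.trans {D : DartSystem H ι} {U : Set D.Vertex} {u v w : D.Vertex}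
    (h1 : D.Flips U u v) (h2 : D.Flips U v w) : D.Flips U u w := by
  intro s hs
  obtain ⟨s', hs', hU', hp'⟩ := h1 s hs
  obtain ⟨s'', hs'', hU'', hp''⟩ := h2 s' hs'
  refine ⟨s'', hs'', fun h hh => (hU'' h hh).trans (hU' h hh), fun h => ?_⟩
  rw [hp'', hp']
  rw [mul_assoc]
  congr 1
  exact (by decide : ∀ a b c : (ZMod 3)ˣ, a * b * (b * c) = a * c) _ _ _

theorem flips_mul_a {U : Set D.Vertex} {h₀ : H} {i₀ : ι} (h0 : D.vtx h₀ ∈ U)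
    (h1 : D.vtx (h₀ * D.a i₀) ∈ U) : D.Flips U (D.vtx h₀) (D.vtx (h₀ * D.a i₀)) := by
  classical
  intro s hs
  have hne := D.vtx_mul_a_ne h₀ i₀
  have horb : ∀ h, (∃ j, ∀ i, D.Orbit h₀ i₀ h i ↔ i = j) ∧
        (D.vtx h = D.vtx h₀ ∧ D.vtx h ≠ D.vtx (h₀ * D.a i₀) ∨
          D.vtx h ≠ D.vtx h₀ ∧ D.vtx h = D.vtx (h₀ * D.a i₀)) ∨
      (∀ i, ¬ D.Orbit h₀ i₀ h i) ∧ D.vtx h ≠ D.vtx h₀ ∧ D.vtx h ≠ D.vtx (h₀ * D.a i₀) := by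
    intro h
    have hζ := D.ne_one
    by_cases c1 : D.vtx h = D.vtx h₀
    · left
      refine ⟨?_, Or.inl ⟨c1, c1 ▸ hne⟩⟩
      have c2 : h ≠ h₀ * D.a i₀ := fun e => hne (by rw [← c1, e])
      have c3 : h ≠ h₀ * D.a i₀ * D.ζ := fun e => hne (by rw [← c1, e, D.vtx_mul_ζ])
      rcases D.vtx_eq_vtx.mp c1.symm with rfl | rfl
      · exact ⟨i₀, fun i => by simp [Orbit, c2, c3, hζ]⟩
      · exact ⟨D.conj i₀, fun i => by simp [Orbit, c2, c3, hζ]⟩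
    · by_cases c2 : D.vtx h = D.vtx (h₀ * D.a i₀)
      · left
        refine ⟨?_, Or.inr ⟨c1, c2⟩⟩
        have c3 : h ≠ h₀ := fun e => c1 (by rw [e])
        have c4 : h ≠ h₀ * D.ζ := fun e => c1 (by rw [e, D.vtx_mul_ζ])
        rcases D.vtx_eq_vtx.mp c2.symm with rfl | rfl
        · exact ⟨D.inv i₀, fun i => by simp only [Orbit, c3, c4]; simp [hζ]⟩
        · exact ⟨D.conj (D.inv i₀), fun i => by simp only [Orbit, c3, c4]; simp [hζ]⟩
      · right
        refine ⟨fun i => ?_, c1, c2⟩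
        rintro (⟨rfl, -⟩ | ⟨rfl, -⟩ | ⟨rfl, -⟩ | ⟨rfl, -⟩) <;> simp at c1 c2
  refine ⟨fun h i => if D.Orbit h₀ i₀ h i then - s h i else s h i, ⟨fun h i => ?_, fun h i => ?_⟩,
    fun h hh => ?_, fun h => ?_⟩
  · simp only [D.orbit_inv, hs.1]
    split_ifs <;> rfl
  · simp only [D.orbit_conj, hs.2]
    split_ifs <;> rfl
  · rcases horb h with ⟨-, h2 | h2⟩ | h2
    · exact absurd (h2.1 ▸ h0) hh
    · exact absurd (h2.2 ▸ h1) hh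
    · simp [h2.1]
  · rcases horb h with ⟨⟨j, hj⟩, h2⟩ | h2
    · have : ∀ i, (if D.Orbit h₀ i₀ h i then - s h i else s h i) =
          s h i * if i = j then -1 else 1 := fun i => by
        simp only [hj]; split_ifs <;> simp
      simp only [sgn, this, Finset.prod_mul_distrib]
      rw [Finset.prod_ite_eq']
      rw [if_pos (Finset.mem_univ _)]
      rcases h2 with h2 | h2
      · rw [if_pos h2.1, if_neg h2.2, mul_one]
      · rw [if_neg h2.1, if_pos h2.2, one_mul]
    · simp [sgn, h2]

theorem flips_of_adj {U : Set D.Vertex} {u v : D.Vertex} (huv : D.graph.Adj u v) (hu : u ∈ U)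
    (hv : v ∈ U) : D.Flips U u v := by
  obtain ⟨h, i, rfl, rfl⟩ := huv
  exact D.flips_mul_a hu hv

theorem flips_of_reachable_induce {U : Set D.Vertex} {u v : U}
    (huv : (D.graph.induce U).Reachable u v) : D.Flips U u v := by
  rw [SimpleGraph.reachable_iff_reflTransGen] at huv
  induction huv with
  | refl => exact Flips.refl _ _
  | @tail b c _ hbc ih => exact ih.trans (D.flips_of_adj hbc b.2 c.2)

theorem flips_of_reachable {u v : D.Vertex} (huv : D.graph.Reachable u v) :
    D.Flips Set.univ u v := by
  rw [SimpleGraph.reachable_iff_reflTransGen] at huv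
  induction huv with
  | refl => exact Flips.refl _ _
  | tail _ hbc ih => exact ih.trans (D.flips_of_adj hbc trivial trivial)

theorem sum_ne_zero_of_prod_eq_neg_one (hι : Fintype.card ι = 4) (f : ι → (ZMod 3)ˣ)
    (hf : ∏ i, f i = -1 ∨ ∀ i j, f i = f j) : ∑ i, (f i : ZMod 3) ≠ 0 := by
  let e : Fin 4 ≃ ι := (Fintype.equivFinOfCardEq hι).symm
  rw [← e.prod_comp, Fin.prod_univ_four] at hf
  rw [← e.sum_comp, Fin.sum_univ_four]
  have key : ∀ a b c d : (ZMod 3)ˣ, a * b * c * d = -1 ∨ (a = b ∧ b = c ∧ c = d) →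
      (a + b + c + d : ZMod 3) ≠ 0 := by decide
  exact key _ _ _ _ (hf.imp_right fun h => ⟨h _ _, h _ _, h _ _⟩)

theorem exists_signing [Finite H] (hι : Fintype.card ι = 4) :
    ∃ s, D.IsSigning s ∧ ∀ h, ∑ i, (s h i : ZMod 3) ≠ 0 := by
  classical
  have hev : Even (Fintype.card ι) := by rw [hι]; decide
  cases nonempty_fintype D.Vertex
  obtain ⟨i₀⟩ : Nonempty ι := Fintype.card_pos_iff.mp (by omega)
  have : Nontrivial D.Vertex := ⟨⟨_, _, D.vtx_mul_a_ne 1 i₀⟩⟩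
  obtain ⟨v₀, hv₀⟩ :=
    D.graph_connected.exists_connected_induce_compl_singleton_of_finite_nontrivial
  obtain ⟨s₀, hs₀, hconst⟩ := D.exists_signing_const v₀
  obtain ⟨r⟩ := hv₀.nonempty
  have hr : r.1 ≠ v₀ := r.2
  have step : ∀ T : Finset D.Vertex, (∀ v ∈ T, v ≠ v₀ ∧ v ≠ r) → ∃ s, D.IsSigning s ∧
      (∀ h, D.vtx h = v₀ → s h = s₀ h) ∧ ∀ h, D.vtx h ∈ T → sgn s h = -1 := by
    intro T
    induction T using Finset.induction_on with
    | empty => exact fun _ => ⟨s₀, hs₀, fun _ _ => rfl, by simp⟩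
    | insert v T hvT ih =>
      intro hT
      obtain ⟨s, hs, hsv, hsT⟩ := ih fun v hv => hT v (Finset.mem_insert_of_mem hv)
      obtain ⟨hvv, hvr⟩ := hT v (Finset.mem_insert_self _ _)
      obtain ⟨g, rfl⟩ := QuotientGroup.mk_surjective v
      by_cases hg : sgn s g = -1
      · refine ⟨s, hs, hsv, fun h hh => ?_⟩
        rcases Finset.mem_insert.mp hh with hh | hh
        · rw [← hg]
          exact D.sgn_congr hs hev hh
        · exact hsT h hh
      · have hg1 : sgn s g = 1 :=
          (by decide : ∀ a : (ZMod 3)ˣ, a ≠ -1 → a = 1) _ hg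
        obtain ⟨s', hs', hU, hp⟩ :=
          D.flips_of_reachable_induce (hv₀.preconnected ⟨D.vtx g, hvv⟩ r) s hs
        refine ⟨s', hs', fun h hh => (hU h (by simp [hh])).trans (hsv h hh), fun h hh => ?_⟩
        rw [hp]
        have hhr := (hT _ hh).2
        rcases Finset.mem_insert.mp hh with hh | hh
        · rw [D.sgn_congr hs hev hh, hg1]
          rw [hh] at hhr
          simp [hh, hhr]
        · have : D.vtx h ≠ D.vtx g := fun e => hvT (Eq.subst (motive := (· ∈ T)) e hh)
          simp [hsT h hh, this, hhr]
  obtain ⟨s, hs, hsv, hsT⟩ := step (Finset.univ.filter fun v => v ≠ v₀ ∧ v ≠ r) (by simp)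
  simp only [Finset.mem_filter, Finset.mem_univ, true_and] at hsT
  have hsc : ∀ h, D.vtx h = v₀ → ∀ i j, s h i = s h j := fun h hh => by
    rw [hsv h hh]; exact hconst h hh
  obtain ⟨g, hgr⟩ := QuotientGroup.mk_surjective r.1
  by_cases hg : sgn s g = -1
  · refine ⟨s, hs, fun h => sum_ne_zero_of_prod_eq_neg_one hι _ ?_⟩
    by_cases h1 : D.vtx h = v₀
    · exact Or.inr (hsc h h1)
    · left
      by_cases h2 : D.vtx h = r
      · rw [← hg]; exact D.sgn_congr hs hev (h2.trans hgr.symm)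
      · exact hsT h ⟨h1, h2⟩
  · have hg1 : sgn s g = 1 := (by decide : ∀ a : (ZMod 3)ˣ, a ≠ -1 → a = 1) _ hg
    obtain ⟨s', hs', -, hp⟩ := D.flips_of_reachable (D.graph_connected.preconnected r.1 v₀) s hs
    refine ⟨s', hs', fun h => sum_ne_zero_of_prod_eq_neg_one hι _ (Or.inl ?_)⟩
    change sgn s' h = -1
    rw [hp]
    by_cases h1 : D.vtx h = v₀
    · have : sgn s h = 1 := by
        rw [sgn, Finset.prod_congr rfl fun i _ => hsc h h1 i i₀, Finset.prod_const,
          Finset.card_univ, hι]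
        exact (by decide : ∀ a : (ZMod 3)ˣ, a ^ 4 = 1) _
      simp [this, h1, hr.symm]
    · by_cases h2 : D.vtx h = r
      · rw [D.sgn_congr hs hev (h2.trans hgr.symm), hg1]
        simp [h2, hr]
      · simp [hsT h ⟨h1, h2⟩, h1, h2]

end DartSystem

end DartSystem

section CayleyFlow

variable {G H : Type*} [Group G] [Group H] [Finite H] [DecidableEq G]

theorem hasCayleyFlow_of_involution (φ : G →* H) (hφ : Function.Surjective φ) {X : Finset G}
    (hX : Subgroup.closure (X : Set G) = ⊤) (hinv : ∀ x ∈ X, x⁻¹ ∈ X) (hcard : X.card = 5)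
    {z : G} (hzX : z ∈ X) (hz : z⁻¹ = z) (hz1 : φ z ≠ 1)
    (hconj : ∀ x ∈ X, x ≠ z → φ (z * x * z) = φ x ∨ φ (z * x * z) = (φ x)⁻¹)
    (hx1 : ∀ x ∈ X, x ≠ z → φ x ≠ 1) (hxz : ∀ x ∈ X, x ≠ z → φ x ≠ φ z) :
    HasCayleyFlow φ X := by
  classical
  have hzz : φ z * φ z = 1 := by
    rw [← map_mul, inv_eq_iff_mul_eq_one.mp hz, map_one]
  let ι := {x // x ∈ X.erase z}
  have hmem : ∀ i : ι, i.1 ∈ X ∧ i.1 ≠ z := fun i => (Finset.mem_erase.mp i.2).symm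
  have hιinv : ∀ i : ι, (i.1)⁻¹ ∈ X.erase z := fun i =>
    Finset.mem_erase.mpr ⟨fun e => (hmem i).2 (by rw [← inv_inv i.1, e, hz]), hinv _ (hmem i).1⟩
  have hcomm : ∀ x : G, φ (z * x⁻¹ * z) = (φ (z * x * z))⁻¹ := fun x => by
    have : φ z⁻¹ = φ z := by rw [hz]
    rw [map_inv] at this
    simp [this, mul_assoc]
  let D : DartSystem H ι :=
    { ζ := φ z
      a := fun i => φ i.1
      inv := fun i => ⟨i.1⁻¹, hιinv i⟩
      conj := fun i => if φ (z * i.1 * z) = φ i.1 then i else ⟨i.1⁻¹, hιinv i⟩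
      inv_inv := fun i => by simp
      conj_conj := fun i => by
        by_cases h : φ (z * i.1 * z) = φ i.1 <;> simp [h, hcomm, -map_mul]
      conj_inv := fun i => by
        by_cases h : φ (z * i.1 * z) = φ i.1 <;> simp [h, hcomm, -map_mul]
      a_inv := fun i => by simp
      mul_a_conj := fun i => by
        have key : φ z * φ (z * i.1 * z) = φ i.1 * φ z := by
          simp only [map_mul, ← mul_assoc, hzz, one_mul]
        rw [← key]
        by_cases h : φ (z * i.1 * z) = φ i.1
        · simp only [h, if_true]
        · rw [if_neg h, map_inv, (hconj _ (hmem i).1 (hmem i).2).resolve_left h]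
      mul_self := hzz
      ne_one := hz1
      a_ne_one := fun i => hx1 _ (hmem i).1 (hmem i).2
      a_ne := fun i => hxz _ (hmem i).1 (hmem i).2
      closure_eq := by
        rw [eq_top_iff, ← MonoidHom.range_eq_top.mpr hφ, MonoidHom.range_eq_map, ← hX,
          MonoidHom.map_closure, Subgroup.closure_le]
        rintro _ ⟨x, hx, rfl⟩
        apply Subgroup.subset_closure
        by_cases h : x = z
        · exact Or.inl (h ▸ rfl)
        · exact Or.inr ⟨⟨x, Finset.mem_erase.mpr ⟨h, hx⟩⟩, rfl⟩ }
  have hι : Fintype.card ι = 4 := by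
    rw [Fintype.card_coe, Finset.card_erase_of_mem hzX, hcard]
  obtain ⟨s, hs, hsum⟩ := D.exists_signing hι
  have hsumz : ∀ h, ∑ i, (s (h * φ z) i : ZMod 3) = - ∑ i, (s h i : ZMod 3) := fun h => by
    rw [← Equiv.sum_comp (Function.Involutive.toPerm D.conj D.conj_conj),
      ← Finset.sum_neg_distrib]
    refine Finset.sum_congr rfl fun i _ => ?_
    have := hs.2 h i
    exact (congrArg Units.val this).trans (Units.val_neg _)
  refine ⟨fun h x => if hx : x ∈ X.erase z then s h ⟨x, hx⟩ else - ∑ i, (s h i : ZMod 3), ?_, ?_, ?_⟩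
  · intro h x _
    by_cases hx : x ∈ X.erase z
    · simp [hx, -Finset.mem_erase]
    · simpa [hx, -Finset.mem_erase] using hsum h
  · intro h x hxX
    by_cases hx : x ∈ X.erase z
    · have := hs.1 h ⟨x, hx⟩
      simp only [hx, hιinv ⟨x, hx⟩, dif_pos]
      exact (congrArg Units.val this).trans (Units.val_neg _)
    · obtain rfl : x = z := by simpa [hxX] using hx
      simp [hz, hsumz]
  · intro h
    rw [← Finset.add_sum_erase _ _ hzX, ← Finset.sum_coe_sort]
    simp only [Finset.notMem_erase, dite_false, Finset.coe_mem, dite_true]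
    exact neg_add_cancel _

end CayleyFlow

/-! ### Ladders -/

section Ladder

variable {H : Type*} [Group H]

/-- An involution `ζ` inverting a normal cyclic subgroup `⟨ξ⟩` of odd order, together with an
element `η` that commutes with `ζ` modulo that subgroup, but not exactly. -/
structure LadderSystem (H : Type*) [Group H] where
  /-- the involution -/
  ζ : H
  /-- a generator of the normal cyclic subgroup -/
  ξ : H
  /-- the transversal element -/
  η : H
  /-- the commutator of the transversal element and the involution -/
  κ : H
  normal : (Subgroup.zpowers ξ).Normal
  mul_self : ζ * ζ = 1
  ζ_mul_ξ : ζ * ξ = ξ⁻¹ * ζ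
  ζ_mul_η : ζ * η = η * κ * ζ
  κ_mem : κ ∈ Subgroup.zpowers ξ
  κ_ne_one : κ ≠ 1
  odd_orderOf : Odd (orderOf ξ)
  ζ_notMem : ζ ∉ Subgroup.zpowers ξ
  η_notMem : η ∉ Subgroup.zpowers ξ
  η_mul_ζ_notMem : η * ζ ∉ Subgroup.zpowers ξ

namespace LadderSystem

variable (L : LadderSystem H)

/-- The normal cyclic subgroup. -/
abbrev N : Subgroup H := Subgroup.zpowers L.ξ

instance : L.N.Normal := L.normal

theorem ζ_inv : L.ζ⁻¹ = L.ζ := inv_eq_of_mul_eq_one_left L.mul_self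

theorem mul_ζ_mul_ζ (h : H) : h * L.ζ * L.ζ = h := by rw [mul_assoc, L.mul_self, mul_one]

theorem ζ_mul_mul_ζ_mem {n : H} (hn : n ∈ L.N) : L.ζ * n * L.ζ ∈ L.N := by
  simpa [L.ζ_inv] using L.normal.conj_mem n hn L.ζ

theorem ζ_mul_ξ_inv : L.ζ * L.ξ⁻¹ = L.ξ * L.ζ := by
  rw [mul_inv_eq_iff_eq_mul, mul_assoc, L.ζ_mul_ξ, mul_inv_cancel_left]

/-- The subgroup generated by the involution and the cyclic subgroup, whose cosets are the
ladders. -/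
def D : Subgroup H where
  carrier := {h | h ∈ L.N ∨ h * L.ζ ∈ L.N}
  one_mem' := Or.inl (one_mem _)
  mul_mem' := by
    rintro g h (hg | hg) (hh | hh)
    · exact Or.inl (mul_mem hg hh)
    · right
      rw [mul_assoc]
      exact mul_mem hg hh
    · right
      have := mul_mem hg (L.ζ_mul_mul_ζ_mem hh)
      rwa [← mul_assoc, ← mul_assoc, L.mul_ζ_mul_ζ] at this
    · left
      have := mul_mem hg (L.ζ_mul_mul_ζ_mem hh)
      rwa [← mul_assoc, ← mul_assoc, ← mul_assoc, L.mul_ζ_mul_ζ, L.mul_ζ_mul_ζ] at this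
  inv_mem' := by
    rintro h (hh | hh)
    · exact Or.inl (inv_mem hh)
    · right
      have := L.ζ_mul_mul_ζ_mem (inv_mem hh)
      simpa [L.ζ_inv, ← mul_assoc, L.mul_self] using this

theorem mem_D {h : H} : h ∈ L.D ↔ h ∈ L.N ∨ h * L.ζ ∈ L.N := Iff.rfl

theorem mem_D_of_mem {n : H} (hn : n ∈ L.N) : n ∈ L.D := Or.inl hn

theorem ζ_mem_D : L.ζ ∈ L.D := Or.inr (by simp [L.mul_self])

theorem ξ_inv_mem_D : L.ξ⁻¹ ∈ L.D := L.mem_D_of_mem (inv_mem (Subgroup.mem_zpowers _))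

theorem η_notMem_D : L.η ∉ L.D := by simp [mem_D, L.η_notMem, L.η_mul_ζ_notMem]

theorem ζ_mul_η_inv : L.ζ * L.η⁻¹ = L.η⁻¹ * (L.η * L.κ⁻¹ * L.η⁻¹) * L.ζ := by
  rw [mul_inv_eq_iff_eq_mul, mul_assoc, L.ζ_mul_η]
  group

theorem conj_mem_D {d : H} (hd : d ∈ L.D) : L.η * d * L.η⁻¹ ∈ L.D := by
  have hn : ∀ n ∈ L.N, L.η * n * L.η⁻¹ ∈ L.D := fun n hn =>
    L.mem_D_of_mem (L.normal.conj_mem n hn L.η)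
  rcases hd with hd | hd
  · exact hn d hd
  · have h1 := mul_mem (mul_mem (hn _ hd) (hn _ (inv_mem L.κ_mem))) L.ζ_mem_D
    convert h1 using 1
    calc L.η * d * L.η⁻¹ = L.η * (d * L.ζ) * (L.ζ * L.η⁻¹) := by
          rw [← mul_assoc, ← mul_assoc, L.mul_ζ_mul_ζ]
      _ = _ := by rw [L.ζ_mul_η_inv]; simp only [mul_assoc]

theorem inv_conj_mem_D [Finite H] {d : H} (hd : d ∈ L.D) : L.η⁻¹ * d * L.η ∈ L.D := by
  have hinj : Function.Injective fun d : L.D =>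
      (⟨L.η * d * L.η⁻¹, L.conj_mem_D d.2⟩ : L.D) := fun a b hab =>
    Subtype.ext (by simpa using congrArg Subtype.val hab)
  obtain ⟨⟨d', hd'⟩, e⟩ := Finite.surjective_of_injective hinj ⟨d, hd⟩
  obtain rfl : L.η * d' * L.η⁻¹ = d := congrArg Subtype.val e
  convert hd' using 1
  group

/-- Signs that are constant on the cosets of the cyclic subgroup and reversed by `ζ`. -/
def IsSigning (σ : H → (ZMod 3)ˣ) : Prop :=
  (∀ h, ∀ n ∈ L.N, σ (h * n) = σ h) ∧ ∀ h, σ (h * L.ζ) = - σ h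

/-- The sign does not change along `η`. -/
def Defect (σ : H → (ZMod 3)ˣ) (h : H) : Prop := σ h = σ (h * L.η⁻¹)

variable {L} {σ : H → (ZMod 3)ˣ}

theorem IsSigning.apply_mul_mul_η_inv (hσ : L.IsSigning σ) (h : H) {n : H} (hn : n ∈ L.N) :
    σ (h * n * L.η⁻¹) = σ (h * L.η⁻¹) := by
  rw [show h * n * L.η⁻¹ = h * L.η⁻¹ * (L.η * n * L.η⁻¹) by group]
  exact hσ.1 _ _ (L.normal.conj_mem n hn L.η)

theorem IsSigning.apply_mul_ζ_mul_η_inv (hσ : L.IsSigning σ) (h : H) :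
    σ (h * L.ζ * L.η⁻¹) = - σ (h * L.η⁻¹) := by
  rw [mul_assoc, L.ζ_mul_η_inv, ← mul_assoc, ← mul_assoc, hσ.2,
    hσ.1 _ _ (L.normal.conj_mem _ (inv_mem L.κ_mem) L.η)]

theorem IsSigning.defect_mul_iff (hσ : L.IsSigning σ) {h d : H} (hd : d ∈ L.D) :
    L.Defect σ (h * d) ↔ L.Defect σ h := by
  have h1 : ∀ h, ∀ n ∈ L.N, L.Defect σ (h * n) ↔ L.Defect σ h := fun h n hn => by
    rw [Defect, Defect, hσ.apply_mul_mul_η_inv h hn, hσ.1 h n hn]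
  rcases hd with hd | hd
  · exact h1 h d hd
  · rw [← h1 h _ hd, ← mul_assoc, Defect, Defect, hσ.2, hσ.apply_mul_ζ_mul_η_inv, neg_inj]

variable (L) in
theorem exists_isSigning [Finite H] :
    ∃ σ, L.IsSigning σ ∧ ∀ h, L.Defect σ h → ¬ L.Defect σ (h * L.η) := by
  classical
  obtain ⟨c, hc1, hc2⟩ := exists_sign L.N L.ζ L.ζ_notMem (L.mul_self ▸ one_mem _)
    (fun n hn => by simpa [L.ζ_inv] using L.ζ_mul_mul_ζ_mem hn)
  obtain ⟨σ, hσ, hmin⟩ := Set.exists_min_image {σ | L.IsSigning σ}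
    (fun σ => {h | L.Defect σ h}.ncard) (Set.toFinite _) ⟨c, hc1, hc2⟩
  refine ⟨σ, hσ, fun g hg hgη => ?_⟩
  let τ : H → (ZMod 3)ˣ := fun h => if g⁻¹ * h ∈ L.D then - σ h else σ h
  have hτD : ∀ h, ∀ d ∈ L.D, (g⁻¹ * (h * d) ∈ L.D ↔ g⁻¹ * h ∈ L.D) := fun h d hd => by
    rw [← mul_assoc]
    exact Subgroup.mul_mem_cancel_right _ hd
  have hτ : L.IsSigning τ := by
    refine ⟨fun h n hn => ?_, fun h => ?_⟩
    · simp only [τ, hτD h n (L.mem_D_of_mem hn), hσ.1 h n hn]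
    · simp only [τ, hτD h _ L.ζ_mem_D, hσ.2 h]
      split_ifs <;> rfl
  have hneg : ∀ a : (ZMod 3)ˣ, a ≠ -a := by decide
  have hdef : ∀ h, L.Defect τ h → L.Defect σ h ∧ g⁻¹ * h ∉ L.D := by
    intro h hh
    have hη : g⁻¹ * h ∈ L.D → g⁻¹ * (h * L.η⁻¹) ∉ L.D := fun h1 h2 => by
      rw [← mul_assoc, Subgroup.mul_mem_cancel_left _ h1] at h2
      exact L.η_notMem_D (by simpa using inv_mem h2)
    by_cases h1 : g⁻¹ * h ∈ L.D
    · exfalso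
      have h3 : L.Defect σ h := by
        have := (hσ.defect_mul_iff (h := g) h1).mpr hg
        rwa [mul_inv_cancel_left] at this
      simp only [Defect, τ, h1, hη h1, if_true, if_false] at hh h3
      exact hneg _ (h3.trans hh.symm)
    · refine ⟨?_, h1⟩
      by_cases h2 : g⁻¹ * (h * L.η⁻¹) ∈ L.D
      · exfalso
        have h3 : L.Defect σ h := by
          have h4 := L.inv_conj_mem_D h2
          have := (hσ.defect_mul_iff (h := g * L.η) h4).mpr hgη
          convert this using 1
          group
        simp only [Defect, τ, h1, h2, if_true, if_false] at hh h3
        exact hneg _ (h3.symm.trans hh)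
      · simpa only [Defect, τ, h1, h2, if_false] using hh
  have hlt : {h | L.Defect τ h}.ncard < {h | L.Defect σ h}.ncard := by
    refine Set.ncard_lt_ncard ⟨fun h hh => (hdef h hh).1, fun hsub => ?_⟩ (Set.toFinite _)
    exact (hdef g (hsub hg)).2 (by simp)
  exact absurd hlt (hmin τ hτ).not_gt

end LadderSystem

theorem exists_zpowers_index [Finite H] (ξ : H) : ∃ k : H → ℕ,
    k 1 = 0 ∧ k ξ⁻¹ + 1 = orderOf ξ ∧ (∀ n ∈ Subgroup.zpowers ξ, k n < orderOf ξ) ∧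
      (∀ n ∈ Subgroup.zpowers ξ, ξ ^ k n = n) ∧
      ∀ n ∈ Subgroup.zpowers ξ, n ≠ 1 → k n = k (n * ξ⁻¹) + 1 := by
  classical
  have hex : ∀ n, ∃ k, n ∈ Subgroup.zpowers ξ → k < orderOf ξ ∧ ξ ^ k = n := fun n => by
    by_cases hn : n ∈ Subgroup.zpowers ξ
    · rw [mem_zpowers_iff_mem_range_orderOf] at hn
      obtain ⟨k, hk, rfl⟩ := Finset.mem_image.mp hn
      exact ⟨k, fun _ => ⟨Finset.mem_range.mp hk, rfl⟩⟩
    · exact ⟨0, fun h => absurd h hn⟩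
  choose k hk using hex
  have hpos := orderOf_pos ξ
  have huniq : ∀ i < orderOf ξ, k (ξ ^ i) = i := fun i hi => by
    have h1 := hk (ξ ^ i) (pow_mem (Subgroup.mem_zpowers ξ) i)
    exact pow_injOn_Iio_orderOf h1.1 hi h1.2
  refine ⟨k, ?_, ?_, fun n hn => (hk n hn).1, fun n hn => (hk n hn).2, fun n hn hn1 => ?_⟩
  · simpa using huniq 0 hpos
  · have h1 : ξ⁻¹ = ξ ^ (orderOf ξ - 1) := by
      rw [inv_eq_iff_mul_eq_one, ← pow_succ', Nat.sub_add_cancel hpos, pow_orderOf_eq_one]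
    rw [h1, huniq _ (by omega)]
    omega
  · obtain ⟨h1, h2⟩ := hk n hn
    have h3 : k n ≠ 0 := fun h => hn1 (by rw [← h2, h, pow_zero])
    have h4 : n * ξ⁻¹ = ξ ^ (k n - 1) := by
      rw [mul_inv_eq_iff_eq_mul, ← pow_succ, Nat.sub_add_cancel (Nat.pos_of_ne_zero h3), h2]
    rw [h4, huniq _ (by omega)]
    omega

theorem exists_alternating [Finite H] (ξ : H) (hξ : Odd (orderOf ξ)) :
    ∃ e : H → (ZMod 3)ˣ, e ξ⁻¹ = e 1 ∧ ∀ n ∈ Subgroup.zpowers ξ, n ≠ 1 → e (n * ξ⁻¹) = - e n := by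
  obtain ⟨k, h0, h1, -, -, hs⟩ := exists_zpowers_index ξ
  refine ⟨fun n => (-1) ^ k n, ?_, fun n hn hn1 => ?_⟩
  · have : Even (k ξ⁻¹) := by
      rw [← h1] at hξ
      exact Nat.not_odd_iff_even.mp fun h => Nat.not_even_iff_odd.mpr hξ h.add_one
    simp only [h0, this.neg_one_pow, pow_zero]
  · simp [hs n hn hn1, pow_succ]

theorem exists_step [Finite H] (ξ κ : H) (hκ : κ ∈ Subgroup.zpowers ξ) (hκ1 : κ ≠ 1) :
    ∃ e : H → (ZMod 3)ˣ, e 1 = -1 ∧ e ξ⁻¹ = 1 ∧ e κ = 1 ∧ e (κ * ξ⁻¹) = -1 ∧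
      ∀ n ∈ Subgroup.zpowers ξ, n ≠ 1 → n ≠ κ → e (n * ξ⁻¹) = e n := by
  obtain ⟨k, h0, h1, hlt, hpow, hs⟩ := exists_zpowers_index ξ
  have hk := hs κ hκ hκ1
  have hkl := hlt κ hκ
  refine ⟨fun n => if k n < k κ then -1 else 1, ?_, ?_, ?_, ?_, fun n hn hn1 hnκ => ?_⟩
  · exact if_pos (by omega)
  · exact if_neg (by omega)
  · exact if_neg (lt_irrefl _)
  · exact if_pos (by omega)
  · have h2 : k n ≠ k κ := fun h => hnκ (by rw [← hpow n hn, h, hpow κ hκ])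
    have h3 := hs n hn hn1
    have h4 : k (n * ξ⁻¹) < k κ ↔ k n < k κ := by omega
    simp only [h4]

end Ladder

section Ladder

variable {H : Type*} [Group H]

namespace LadderSystem

variable (L : LadderSystem H)

/-- A function on the subgroup `D` given by a function on one side of the ladder and, up to a sign,
its translate on the other side. -/
noncomputable def ladderFun (e : H → (ZMod 3)ˣ) (μ : (ZMod 3)ˣ) (u : H) : (ZMod 3)ˣ :=
  open Classical in if u ∈ L.N then e u else μ * e (u * L.ζ * L.ξ⁻¹)

theorem mul_ζ_notMem {n : H} (hn : n ∈ L.N) : n * L.ζ ∉ L.N := fun h =>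
  L.ζ_notMem ((Subgroup.mul_mem_cancel_left _ hn).mp h)

variable (e : H → (ZMod 3)ˣ) (μ : (ZMod 3)ˣ) {n : H}

theorem ladderFun_of_mem (hn : n ∈ L.N) : L.ladderFun e μ n = e n := if_pos hn

theorem ladderFun_mul_ζ (hn : n ∈ L.N) :
    L.ladderFun e μ (n * L.ζ) = μ * e (n * L.ξ⁻¹) := by
  rw [ladderFun, if_neg (L.mul_ζ_notMem hn), L.mul_ζ_mul_ζ]

theorem ladderFun_mul_ξ_inv (hn : n ∈ L.N) :
    L.ladderFun e μ (n * L.ξ⁻¹) = e (n * L.ξ⁻¹) :=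
  L.ladderFun_of_mem e μ (mul_mem hn (inv_mem (Subgroup.mem_zpowers _)))

theorem ladderFun_mul_ζ_mul_ξ_inv (hn : n ∈ L.N) :
    L.ladderFun e μ (n * L.ζ * L.ξ⁻¹) = μ * e n := by
  rw [mul_assoc, L.ζ_mul_ξ_inv, ← mul_assoc,
    L.ladderFun_mul_ζ e μ (mul_mem hn (Subgroup.mem_zpowers _)), mul_inv_cancel_right]

/-- A representative of the ladder of an element. -/
noncomputable def rep (h : H) : H := (h : H ⧸ L.D).out

theorem rep_inv_mul_mem (h : H) : (L.rep h)⁻¹ * h ∈ L.D :=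
  QuotientGroup.eq.mp (Quotient.out_eq (h : H ⧸ L.D))

theorem rep_mul (h : H) {d : H} (hd : d ∈ L.D) : L.rep (h * d) = L.rep h := by
  simp [rep, QuotientGroup.mk_mul_of_mem h hd]

theorem rep_rep (h : H) : L.rep (L.rep h) = L.rep h := by
  conv_rhs => rw [← mul_inv_cancel_left (L.rep h) h, L.rep_mul _ (L.rep_inv_mul_mem h)]

/-- The net contribution to a vertex of two signs on the arcs in the directions `ξ` and `η`. -/
def net (f r : H → (ZMod 3)ˣ) (h : H) : ZMod 3 :=
  f h - f (h * L.ξ⁻¹) + r h - r (h * L.η⁻¹)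

theorem exists_net_ne_zero [Finite H] : ∃ f r : H → (ZMod 3)ˣ, ∀ h,
    L.net f r h ≠ 0 ∧ L.net f r (h * L.ζ) = - L.net f r h := by
  classical
  obtain ⟨σ, hσ, hdef⟩ := L.exists_isSigning
  obtain ⟨e, he0, he⟩ := exists_alternating L.ξ L.odd_orderOf
  obtain ⟨e', he'1, he'ξ, he'κ, he'κξ, he'⟩ := exists_step L.ξ L.κ L.κ_mem L.κ_ne_one
  let f : H → (ZMod 3)ˣ := fun h =>
    if L.Defect σ h then L.ladderFun e 1 ((L.rep h)⁻¹ * h)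
    else if L.Defect σ (h * L.η⁻¹) then
      σ (L.rep (h * L.η⁻¹) * L.η) * L.ladderFun e' (-1) ((L.rep (h * L.η⁻¹) * L.η)⁻¹ * h)
    else 1
  let r : H → (ZMod 3)ˣ := fun h =>
    if L.Defect σ h ∧ (h = L.rep h ∨ h = L.rep h * L.ζ) then - σ h else σ h
  have hζ1 : L.ζ ≠ 1 := fun h => L.ζ_notMem (h ▸ one_mem _)
  have hdη : ∀ h, ∀ d ∈ L.D, (L.Defect σ (h * d * L.η⁻¹) ↔ L.Defect σ (h * L.η⁻¹)) :=
    fun h d hd => by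
      rw [show h * d * L.η⁻¹ = h * L.η⁻¹ * (L.η * d * L.η⁻¹) by group]
      exact hσ.defect_mul_iff (L.conj_mem_D hd)
  -- ladders on which the sign is a defect
  have hA : ∀ g, L.rep g = g → L.Defect σ g → ∀ n ∈ L.N,
      L.net f r (g * n) ≠ 0 ∧ L.net f r (g * n * L.ζ) = - L.net f r (g * n) := by
    intro g hg hgd n hn
    have hf : ∀ d ∈ L.D, f (g * d) = L.ladderFun e 1 d := fun d hd => by
      simp only [f, hσ.defect_mul_iff hd, hgd, if_true, L.rep_mul g hd, hg, inv_mul_cancel_left]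
    have hr : ∀ d ∈ L.D, r (g * d) = if d = 1 ∨ d = L.ζ then - σ (g * d) else σ (g * d) :=
      fun d hd => by
        simp only [r, hσ.defect_mul_iff hd, hgd, true_and, L.rep_mul g hd, hg, mul_eq_left,
          mul_right_inj]
    have hr' : ∀ d ∈ L.D, r (g * d * L.η⁻¹) = σ (g * d) := fun d hd => by
      have h1 : L.Defect σ (g * d) := (hσ.defect_mul_iff hd).mpr hgd
      have h2 : ¬ L.Defect σ (g * d * L.η⁻¹) := fun h => by
        have := hdef _ h
        rw [inv_mul_cancel_right] at this
        exact this h1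
      simp only [r, h2, false_and, if_false]
      exact h1.symm
    have hnD := L.mem_D_of_mem hn
    have hnξ := mul_mem hnD L.ξ_inv_mem_D
    have hnζ := mul_mem hnD L.ζ_mem_D
    have hnζξ := mul_mem hnζ L.ξ_inv_mem_D
    have e1 : L.net f r (g * n) =
        e n - e (n * L.ξ⁻¹) + (if n = 1 then - σ g else σ g : (ZMod 3)ˣ) - σ g := by
      have hn' : n ≠ L.ζ := fun h => L.ζ_notMem (h ▸ hn)
      rw [net, mul_assoc g n L.ξ⁻¹, hf _ hnD, hf _ hnξ, hr _ hnD, hr' _ hnD,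
        L.ladderFun_of_mem e 1 hn, L.ladderFun_mul_ξ_inv e 1 hn, hσ.1 g n hn]
      simp only [hn', or_false]
    have e2 : L.net f r (g * n * L.ζ) =
        e (n * L.ξ⁻¹) - e n + (if n = 1 then σ g else - σ g : (ZMod 3)ˣ) + σ g := by
      have hn' : n * L.ζ ≠ 1 := fun h => L.mul_ζ_notMem hn (h ▸ one_mem _)
      rw [net, mul_assoc g n L.ζ, mul_assoc g (n * L.ζ) L.ξ⁻¹, hf _ hnζ, hf _ hnζξ, hr _ hnζ,
        hr' _ hnζ, L.ladderFun_mul_ζ e 1 hn, L.ladderFun_mul_ζ_mul_ξ_inv e 1 hn, ← mul_assoc,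
        hσ.2, hσ.1 g n hn]
      simp only [hn', false_or, mul_eq_right, one_mul, neg_neg, Units.val_neg, sub_neg_eq_add]
    rw [e1, e2]
    by_cases hn1 : n = 1
    · subst hn1
      rw [one_mul, he0, if_pos rfl, if_pos rfl]
      exact (by decide : ∀ a b : (ZMod 3)ˣ, (a - a + (-b : (ZMod 3)ˣ) - b : ZMod 3) ≠ 0 ∧
        (a - a + b + b : ZMod 3) = - (a - a + (-b : (ZMod 3)ˣ) - b)) _ _
    · rw [if_neg hn1, if_neg hn1, he n hn hn1]
      exact (by decide : ∀ a b : (ZMod 3)ˣ, (a - (-a : (ZMod 3)ˣ) + b - b : ZMod 3) ≠ 0 ∧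
        ((-a : (ZMod 3)ˣ) - a + (-b : (ZMod 3)ˣ) + b : ZMod 3) =
          - (a - (-a : (ZMod 3)ˣ) + b - b)) _ _
  -- ladders following a defect
  have hC : ∀ g, L.rep g = g → L.Defect σ g → ∀ n ∈ L.N,
      L.net f r (g * L.η * n) ≠ 0 ∧
        L.net f r (g * L.η * n * L.ζ) = - L.net f r (g * L.η * n) := by
    intro g hg hgd n hn
    have hnd : ∀ d ∈ L.D, ¬ L.Defect σ (g * L.η * d) := fun d hd => by
      rw [hσ.defect_mul_iff hd]
      exact hdef g hgd
    have hd' : ∀ d ∈ L.D, L.Defect σ (g * L.η * d * L.η⁻¹) := fun d hd => by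
      rw [hdη _ d hd, mul_inv_cancel_right]
      exact hgd
    have hrep : ∀ d ∈ L.D, L.rep (g * L.η * d * L.η⁻¹) = g := fun d hd => by
      rw [show g * L.η * d * L.η⁻¹ = g * (L.η * d * L.η⁻¹) by group,
        L.rep_mul g (L.conj_mem_D hd), hg]
    have hf : ∀ d ∈ L.D, f (g * L.η * d) = σ (g * L.η) * L.ladderFun e' (-1) d := fun d hd => by
      simp only [f, hnd d hd, hd' d hd, hrep d hd, if_true, if_false, inv_mul_cancel_left]
    have hr : ∀ d ∈ L.D, r (g * L.η * d) = σ (g * L.η * d) := fun d hd => by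
      simp only [r, hnd d hd, false_and, if_false]
    have hr' : ∀ d ∈ L.D, r (g * L.η * d * L.η⁻¹) =
        if d = 1 ∨ d = L.κ * L.ζ then σ (g * L.η * d) else - σ (g * L.η * d) := fun d hd => by
      have h1 : σ (g * L.η * d * L.η⁻¹) = - σ (g * L.η * d) :=
        (by decide : ∀ a b : (ZMod 3)ˣ, a ≠ b → b = - a) _ _ (hnd d hd)
      have h2 : g * L.η * d * L.η⁻¹ = g ↔ d = 1 := by
        rw [mul_inv_eq_iff_eq_mul, mul_eq_left]
      have h3 : g * L.η * d * L.η⁻¹ = g * L.ζ ↔ d = L.κ * L.ζ := by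
        rw [mul_inv_eq_iff_eq_mul, mul_assoc, mul_assoc, L.ζ_mul_η, mul_right_inj, mul_assoc,
          mul_right_inj]
      simp only [r, hd' d hd, true_and, hrep d hd, h1, h2, h3, neg_neg]
    have hnD := L.mem_D_of_mem hn
    have hnξ := mul_mem hnD L.ξ_inv_mem_D
    have hnζ := mul_mem hnD L.ζ_mem_D
    have hnζξ := mul_mem hnζ L.ξ_inv_mem_D
    have e1 : L.net f r (g * L.η * n) =
        (σ (g * L.η) * e' n : (ZMod 3)ˣ) - (σ (g * L.η) * e' (n * L.ξ⁻¹) : (ZMod 3)ˣ) +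
          σ (g * L.η) - (if n = 1 then σ (g * L.η) else - σ (g * L.η) : (ZMod 3)ˣ) := by
      have hn' : n ≠ L.κ * L.ζ := fun h => L.mul_ζ_notMem L.κ_mem (h ▸ hn)
      rw [net, mul_assoc (g * L.η) n L.ξ⁻¹, hf _ hnD, hf _ hnξ, hr _ hnD, hr' _ hnD,
        L.ladderFun_of_mem e' _ hn, L.ladderFun_mul_ξ_inv e' _ hn, hσ.1 _ n hn]
      simp only [hn', or_false]
    have e2 : L.net f r (g * L.η * n * L.ζ) =
        (σ (g * L.η) * (-1 * e' (n * L.ξ⁻¹)) : (ZMod 3)ˣ) - (σ (g * L.η) * (-1 * e' n) : (ZMod 3)ˣ)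
          - σ (g * L.η) - (if n = L.κ then - σ (g * L.η) else σ (g * L.η) : (ZMod 3)ˣ) := by
      have hn' : n * L.ζ ≠ 1 := fun h => L.mul_ζ_notMem hn (h ▸ one_mem _)
      rw [net, mul_assoc (g * L.η) n L.ζ, mul_assoc (g * L.η) (n * L.ζ) L.ξ⁻¹, hf _ hnζ,
        hf _ hnζξ, hr _ hnζ, hr' _ hnζ, L.ladderFun_mul_ζ e' _ hn,
        L.ladderFun_mul_ζ_mul_ξ_inv e' _ hn, ← mul_assoc (g * L.η) n L.ζ, hσ.2, hσ.1 _ n hn]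
      simp only [hn', false_or, mul_left_inj, neg_neg, Units.val_neg, ← sub_eq_add_neg]
    rw [e1, e2]
    generalize σ (g * L.η) = a
    by_cases hn1 : n = 1
    · subst hn1
      rw [one_mul, he'1, he'ξ, if_pos rfl, if_neg L.κ_ne_one.symm]
      revert a
      decide
    · by_cases hnκ : n = L.κ
      · subst hnκ
        rw [he'κ, he'κξ, if_pos rfl, if_neg hn1]
        revert a
        decide
      · rw [he' n hn hn1 hnκ, if_neg hn1, if_neg hnκ]
        generalize e' n = b
        revert a b
        decide
  refine ⟨f, r, fun h => ?_⟩
  have flip : ∀ h, L.net f r (h * L.ζ) ≠ 0 ∧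
      L.net f r (h * L.ζ * L.ζ) = - L.net f r (h * L.ζ) →
      L.net f r h ≠ 0 ∧ L.net f r (h * L.ζ) = - L.net f r h := by
    rintro h ⟨h1, h2⟩
    rw [L.mul_ζ_mul_ζ] at h2
    exact ⟨by rw [h2]; exact neg_ne_zero.mpr h1, by rw [h2, neg_neg]⟩
  by_cases hd : L.Defect σ h
  · have hmem := L.rep_inv_mul_mem h
    have hrd : L.Defect σ (L.rep h) := by
      rw [← hσ.defect_mul_iff hmem, mul_inv_cancel_left]
      exact hd
    have key := hA (L.rep h) (L.rep_rep h) hrd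
    rcases hmem with hm | hm
    · simpa using key _ hm
    · apply flip
      simpa [mul_assoc] using key _ hm
  · by_cases hd' : L.Defect σ (h * L.η⁻¹)
    · have hmem := L.rep_inv_mul_mem (h * L.η⁻¹)
      have hrd : L.Defect σ (L.rep (h * L.η⁻¹)) := by
        rw [← hσ.defect_mul_iff hmem, mul_inv_cancel_left]
        exact hd'
      have key := hC (L.rep (h * L.η⁻¹)) (L.rep_rep _) hrd
      have hm' := L.inv_conj_mem_D hmem
      rw [show L.η⁻¹ * ((L.rep (h * L.η⁻¹))⁻¹ * (h * L.η⁻¹)) * L.η =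
        (L.rep (h * L.η⁻¹) * L.η)⁻¹ * h by group] at hm'
      rcases hm' with hm | hm
      · simpa only [mul_inv_cancel_left] using key _ hm
      · apply flip
        have := key _ hm
        rwa [mul_assoc _ h L.ζ, mul_inv_cancel_left] at this
    · have hξζ := L.ξ_inv_mem_D
      have hζD := L.ζ_mem_D
      have hf : ∀ d ∈ L.D, f (h * d) = 1 := fun d hd1 => by
        simp only [f, hσ.defect_mul_iff hd1, hdη h d hd1, hd, hd', if_false]
      have hr : ∀ d ∈ L.D, r (h * d) = σ (h * d) := fun d hd1 => by
        simp only [r, hσ.defect_mul_iff hd1, hd, false_and, if_false]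
      have hr' : ∀ d ∈ L.D, r (h * d * L.η⁻¹) = σ (h * d * L.η⁻¹) := fun d hd1 => by
        simp only [r, hdη h d hd1, hd', false_and, if_false]
      have h1 : σ (h * L.η⁻¹) = - σ h :=
        (by decide : ∀ a b : (ZMod 3)ˣ, a ≠ b → b = - a) _ _ hd
      have e1 : L.net f r h = σ h + σ h := by
        have a1 := hf 1 (one_mem _)
        have a2 := hr 1 (one_mem _)
        have a3 := hr' 1 (one_mem _)
        rw [mul_one] at a1 a2 a3
        rw [net, hf _ hξζ, a1, a2, a3, h1]
        simp
      have e2 : L.net f r (h * L.ζ) = - (σ h + σ h) := by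
        rw [net, mul_assoc h L.ζ L.ξ⁻¹, hf _ (mul_mem hζD hξζ), hf _ hζD, hr _ hζD, hr' _ hζD,
          hσ.apply_mul_ζ_mul_η_inv, hσ.2, h1]
        simp only [neg_neg, Units.val_neg]
        ring
      rw [e1, e2]
      exact ⟨(by decide : ∀ a : (ZMod 3)ˣ, (a + a : ZMod 3) ≠ 0) _, rfl⟩

end LadderSystem

end Ladder

/-! ### Groups with cyclic derived subgroup -/

section CyclicCommutator

variable {G : Type*} [Group G]

theorem isCyclic_commutator_of_isCyclic_map
    (h : IsCyclic ((commutator (commutator G)).map (commutator G).subtype : Subgroup G))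
    [IsZGroup (commutator G)] [Finite G] : IsCyclic (commutator G) := by
  suffices h : commutator (commutator G) ≤ Subgroup.center (commutator G) by
    rw [← Abelianization.ker_of (commutator G)] at h
    let _ := commGroupOfCyclicCenterQuotient Abelianization.of h
    infer_instance
  suffices h : (commutator (commutator G)).map (commutator G).subtype ≤
      Subgroup.centralizer (commutator G) by
    simpa [SetLike.le_def, Subgroup.mem_center_iff, Subgroup.mem_centralizer_iff] using h
  rw [Subgroup.map_subtype_commutator] at h ⊢
  rw [Subgroup.le_centralizer_iff]
  let _ := (h.mulAutMulEquiv _).toMonoidHom.commGroupOfInjective (h.mulAutMulEquiv _).injective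
  have h := Abelianization.commutator_subset_ker ⁅commutator G, commutator G⁆.normalizerMonoidHom
  rwa [Subgroup.normalizerMonoidHom_ker, Subgroup.normalizer_eq_top,
    ← Subgroup.map_subtype_le_map_subtype, Subgroup.map_subtype_commutator,
      Subgroup.map_subgroupOf_eq_of_le le_top] at h

theorem isCyclic_commutator_of_squarefree [Finite G] (h : Squarefree (Nat.card (commutator G))) :
    IsCyclic (commutator G) := by
  have := IsZGroup.of_squarefree h
  have hc := IsZGroup.isCyclic_commutator (commutator G)
  exact isCyclic_commutator_of_isCyclic_map (isCyclic_of_surjective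
    ((commutator (commutator G)).equivMapOfInjective _ (commutator G).subtype_injective)
    (MulEquiv.surjective _))

theorem card_commutator_subgroup_dvd [Finite G] (S : Subgroup G) :
    Nat.card (commutator S) ∣ Nat.card (commutator G) := by
  rw [Nat.card_congr ((commutator S).equivMapOfInjective _ S.subtype_injective).toEquiv]
  refine Subgroup.card_dvd_of_le ?_
  rw [Subgroup.map_subtype_commutator, commutator_def]
  exact Subgroup.commutator_mono le_top le_top

theorem exists_conj_eq_zpow [IsCyclic (commutator G)] (g : G) :
    ∃ k : ℤ, ∀ a ∈ commutator G, g * a * g⁻¹ = a ^ k := by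
  obtain ⟨k, hk⟩ := MonoidHom.map_cyclic
    (MulAut.conjNormal g : commutator G ≃* commutator G).toMonoidHom
  exact ⟨k, fun a ha => by simpa using congrArg Subtype.val (hk ⟨a, ha⟩)⟩

theorem normal_of_le_commutator [IsCyclic (commutator G)] {N : Subgroup G}
    (hN : N ≤ commutator G) : N.Normal := by
  refine ⟨fun a ha g => ?_⟩
  obtain ⟨k, hk⟩ := exists_conj_eq_zpow g
  rw [hk a (hN ha)]
  exact zpow_mem ha k

theorem commute_of_mem_commutator [IsCyclic (commutator G)] {a b : G} (ha : a ∈ commutator G)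
    (hb : b ∈ commutator G) : a * b = b * a := by
  let _ := IsCyclic.commGroup (α := commutator G)
  exact congrArg Subtype.val (mul_comm (⟨a, ha⟩ : commutator G) ⟨b, hb⟩)

end CyclicCommutator

/-! ### Connection sets of size five -/

section FiveElements

variable {G H : Type*} [Group G] [Group H]

theorem LadderSystem.hasCayleyFlow [Finite H] [DecidableEq G] (φ : G →* H) (L : LadderSystem H)
    {x y z : G} (hζ : L.ζ = φ z) (hξ : L.ξ = φ x) (hη : L.η = φ y) (hz : z⁻¹ = z) (hx : x⁻¹ ≠ x)
    (hy : y⁻¹ ≠ y) (hxy : x ≠ y) (hxy' : x⁻¹ ≠ y) : HasCayleyFlow φ {z, x, x⁻¹, y, y⁻¹} := by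
  obtain ⟨f, r, hfr⟩ := L.exists_net_ne_zero
  have hxz : x ≠ z := by rintro rfl; exact hx hz
  have hyz : y ≠ z := by rintro rfl; exact hy hz
  have hxz' : x⁻¹ ≠ z := fun h => hxz (by rw [← inv_inv x, h, hz])
  have hyz' : y⁻¹ ≠ z := fun h => hyz (by rw [← inv_inv y, h, hz])
  have hyx : y⁻¹ ≠ x := fun h => hxy' (by rw [← h, inv_inv])
  have hyx' : y⁻¹ ≠ x⁻¹ := fun h => hxy (inv_injective h).symm
  refine ⟨fun h g => if g = z then - L.net f r h else if g = x then (f h : ZMod 3) else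
    if g = x⁻¹ then - f (h * L.ξ⁻¹) else if g = y then r h else - r (h * L.η⁻¹), ?_, ?_, ?_⟩
  · rintro h g -
    dsimp only
    split_ifs
    · exact neg_ne_zero.mpr (hfr h).1
    · exact (f h).ne_zero
    · exact neg_ne_zero.mpr (Units.ne_zero _)
    · exact (r h).ne_zero
    · exact neg_ne_zero.mpr (Units.ne_zero _)
  · intro h g hg
    simp only [Finset.mem_insert, Finset.mem_singleton] at hg
    rcases hg with rfl | rfl | rfl | rfl | rfl
    · simp [hz, ← hζ, hfr]
    · simp [hxz, hxz', hx, hξ]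
    · simp [hxz, hxz', hx, hξ]
    · simp [hyz, hyz', hy, hη, hyx, hyx', hxy.symm, hxy'.symm]
    · simp [hyz, hyz', hy, hη, hyx, hxy.symm, hxy'.symm]
  · intro h
    rw [Finset.sum_insert, Finset.sum_insert, Finset.sum_insert, Finset.sum_pair hy.symm]
    · simp [hxz, hxz', hx, hyz, hyz', hy, hyx, hxy.symm, hxy'.symm, LadderSystem.net]
      ring
    · simp [hxy', hxy]
    · simp [hx.symm, hxy, hyx.symm]
    · simp [hxz.symm, hxz'.symm, hyz.symm, hyz'.symm]

theorem exists_inv_eq_self_of_odd_card {X : Finset G} (hinv : ∀ x ∈ X, x⁻¹ ∈ X)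
    (hX : Odd X.card) : ∃ z ∈ X, z⁻¹ = z := by
  classical
  by_contra! h
  have : ∑ x ∈ X, (1 : ZMod 2) = 0 :=
    Finset.sum_involution (fun x _ => x⁻¹) (fun _ _ => by decide) (fun x hx _ => h x hx) hinv
      fun x _ => inv_inv x
  rw [Finset.sum_const, nsmul_one, ZMod.natCast_eq_zero_iff_even] at this
  exact Nat.not_even_iff_odd.mpr hX this

theorem inv_mem_sdiff [DecidableEq G] {X Y : Finset G} (hX : ∀ x ∈ X, x⁻¹ ∈ X)
    (hY : ∀ x ∈ Y, x⁻¹ ∈ Y) : ∀ x ∈ X \ Y, x⁻¹ ∈ X \ Y := fun x hx => by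
  rw [Finset.mem_sdiff] at hx ⊢
  exact ⟨hX x hx.1, fun h => hx.2 (by simpa using hY _ h)⟩

theorem eq_pair_of_card_eq_two [DecidableEq G] {X : Finset G} (hinv : ∀ x ∈ X, x⁻¹ ∈ X)
    (hcard : X.card = 2) : (∃ x, x⁻¹ ≠ x ∧ X = {x, x⁻¹}) ∨
      ∃ a b, a⁻¹ = a ∧ b⁻¹ = b ∧ a ≠ b ∧ X = {a, b} := by
  obtain ⟨a, b, hab, rfl⟩ := Finset.card_eq_two.mp hcard
  have ha := hinv a (by simp)
  have hb := hinv b (by simp)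
  simp only [Finset.mem_insert, Finset.mem_singleton] at ha hb
  rcases ha with ha | ha
  · refine Or.inr ⟨a, b, ha, hb.resolve_left fun h => hab ?_, hab, rfl⟩
    rw [← ha, ← h, inv_inv]
  · exact Or.inl ⟨a, by rw [ha]; exact hab.symm, by rw [ha]⟩

theorem hasCayleyFlow_of_card_eq_two {X : Finset G} (h1 : (1 : G) ∉ X) (hinv : ∀ x ∈ X, x⁻¹ ∈ X)
    (hcard : X.card = 2) : HasCayleyFlow (MonoidHom.id G) X := by
  classical
  rcases eq_pair_of_card_eq_two hinv hcard with ⟨x, hx, rfl⟩ | ⟨a, b, ha, hb, hab, rfl⟩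
  · exact hasCayleyFlow_pair_inv hx
  · simp only [Finset.mem_insert, Finset.mem_singleton, not_or] at h1
    exact hasCayleyFlow_pair_involutions ha hb (Ne.symm h1.1) (Ne.symm h1.2) hab

theorem hasCayleyFlow_of_sdiff [DecidableEq G] {X Y : Finset G} (h1 : (1 : G) ∉ X)
    (hinv : ∀ x ∈ X, x⁻¹ ∈ X) (hYX : Y ⊆ X) (hYinv : ∀ x ∈ Y, x⁻¹ ∈ Y)
    (hcard : X.card = Y.card + 2) (hY : HasCayleyFlow (MonoidHom.id G) Y) :
    HasCayleyFlow (MonoidHom.id G) X := by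
  have hsd := inv_mem_sdiff hinv hYinv
  rw [← Finset.union_sdiff_of_subset hYX]
  refine hY.disjoint_union (hasCayleyFlow_of_card_eq_two (fun h => h1 (Finset.mem_sdiff.mp h).1)
    hsd ?_) Finset.disjoint_sdiff hYinv hsd
  rw [Finset.card_sdiff_of_subset hYX, hcard, Nat.add_sub_cancel_left]

theorem hasCayleyFlow_triple [DecidableEq G] (φ : G →* H) (c : H → (ZMod 3)ˣ) {z a b : G}
    (hz : z⁻¹ = z) (ha : a⁻¹ = a) (hb : b⁻¹ = b) (hza : z ≠ a) (hzb : z ≠ b) (hab : a ≠ b)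
    (hcz : ∀ h, c (h * φ z) = - c h) (hca : ∀ h, c (h * φ a) = - c h)
    (hcb : ∀ h, c (h * φ b) = - c h) : HasCayleyFlow φ {z, a, b} := by
  refine hasCayleyFlow_of_sign φ _ c (fun _ => 1) ?_ ?_ (fun _ _ => one_ne_zero) ?_
  · simp [hz, ha, hb]
  · simp only [Finset.mem_insert, Finset.mem_singleton]
    rintro x (rfl | rfl | rfl)
    exacts [hcz, hca, hcb]
  · rw [Finset.sum_const, Finset.card_eq_three.mpr ⟨z, a, b, hza, hzb, hab, rfl⟩]
    decide

/-- Three involutions inverting a common non-involution. -/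
theorem hasCayleyFlow_triple_of_conj_eq_inv [DecidableEq G] {z a b x : G}
    (hz : z⁻¹ = z) (ha : a⁻¹ = a) (hb : b⁻¹ = b) (hza : z ≠ a) (hzb : z ≠ b) (hab : a ≠ b)
    (hx : x⁻¹ ≠ x) (hzx : z * x * z⁻¹ = x⁻¹) (hax : a * x * a⁻¹ = x⁻¹)
    (hbx : b * x * b⁻¹ = x⁻¹) : HasCayleyFlow (MonoidHom.id G) {z, a, b} := by
  have hconj : ∀ {g : G}, g * x * g⁻¹ = x⁻¹ → g * x = x⁻¹ * g ∧ g * x⁻¹ = x * g := by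
    intro g hg
    have h : SemiconjBy g x x⁻¹ := eq_mul_of_mul_inv_eq hg
    exact ⟨h, by simpa using h.inv_right.eq⟩
  have hmem : ∀ {g : G}, g * x * g⁻¹ = x⁻¹ → z * g ∈ Subgroup.centralizer {x} := by
    intro g hg
    rw [Subgroup.mem_centralizer_singleton_iff, mul_assoc, (hconj hg).1, ← mul_assoc,
      (hconj hzx).2, mul_assoc]
  have hzz : z * z = 1 := by rw [← inv_eq_iff_mul_eq_one, hz]
  obtain ⟨c, hc1, hc2⟩ := exists_sign (Subgroup.centralizer {x}) z
    (fun h => hx (by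
      rw [← hzx, Subgroup.mem_centralizer_singleton_iff.mp h, mul_inv_cancel_right]))
    (hzz ▸ Subgroup.one_mem _) (fun g hg => by
      rw [Subgroup.mem_centralizer_singleton_iff] at hg ⊢
      have hg' : g * x⁻¹ = x⁻¹ * g := (show Commute g x from hg).inv_right
      rw [hz, mul_assoc, (hconj hzx).1, mul_assoc, ← mul_assoc g, hg', ← mul_assoc, ← mul_assoc,
        (hconj hzx).2]
      simp only [mul_assoc])
  have hc3 : ∀ {g : G}, g * x * g⁻¹ = x⁻¹ → ∀ h, c (h * g) = - c h := fun {g} hg h => by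
    rw [← hc2, ← hc1 (h * z) _ (hmem hg), ← mul_assoc, mul_assoc h z z, hzz, mul_one]
  exact hasCayleyFlow_triple _ c hz ha hb hza hzb hab (hc3 hzx) (hc3 hax) (hc3 hbx)

/-- Three involutions, the first central and the second equal to it modulo the kernel. -/
theorem hasCayleyFlow_triple_of_map_eq [DecidableEq G] (φ : G →* H) {z a b : G}
    (hz : z⁻¹ = z) (ha : a⁻¹ = a) (hb : b⁻¹ = b) (hza : z ≠ a) (hzb : z ≠ b) (hab : a ≠ b)
    (hcentral : ∀ g, φ z * g = g * φ z) (hz1 : φ z ≠ 1) (hb1 : φ b ≠ 1) (haz : φ a = φ z) :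
    HasCayleyFlow φ {z, a, b} := by
  have hzz : φ z * φ z = 1 := by rw [← map_mul, inv_eq_iff_mul_eq_one.mp hz, map_one]
  have hbb : φ b * φ b = 1 := by rw [← map_mul, inv_eq_iff_mul_eq_one.mp hb, map_one]
  obtain ⟨c, hc1, hc2⟩ := exists_sign (Subgroup.zpowers (φ z * φ b)) (φ z)
    (fun h => by
      rcases eq_one_or_eq_of_mem_zpowers
        (by rw [mul_assoc, ← mul_assoc (φ b), ← hcentral (φ b), mul_assoc, hbb, mul_one, hzz]) h with h | h
      · exact hz1 h
      · exact hb1 (by simpa using h))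
    (hzz ▸ Subgroup.one_mem _) (fun g hg => by rwa [mul_assoc, ← hcentral, inv_mul_cancel_left])
  refine hasCayleyFlow_triple φ c hz ha hb hza hzb hab hc2 (haz ▸ hc2) fun h => ?_
  rw [← hc2, ← hc1 (h * φ z) _ (Subgroup.mem_zpowers _), ← mul_assoc, mul_assoc h, hzz, mul_one]

end FiveElements

/-! ### The main theorem -/

section Main

variable {G : Type*} [Group G]

/-- The elements of the derived subgroup inverted by conjugation with `z`. -/
def invertedSubgroup [IsCyclic (commutator G)] (z : G) : Subgroup G where
  carrier := {k | k ∈ commutator G ∧ z * k * z⁻¹ = k⁻¹}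
  one_mem' := ⟨one_mem _, by simp⟩
  mul_mem' := fun {a b} ha hb => ⟨mul_mem ha.1 hb.1, by
    rw [← conj_mul, ha.2, hb.2, ← mul_inv_rev, commute_of_mem_commutator ha.1 hb.1]⟩
  inv_mem' := fun {a} ha => ⟨inv_mem ha.1, by rw [← conj_inv, ha.2]⟩

variable [IsCyclic (commutator G)]

instance (z : G) : (invertedSubgroup z).Normal := normal_of_le_commutator fun _ h => h.1

theorem conj_mul_inv_mem_invertedSubgroup {z : G} (hz : z⁻¹ = z) (g : G) :
    z * g * z * g⁻¹ ∈ invertedSubgroup z := by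
  have hzz : z * z = 1 := by rw [← inv_eq_iff_mul_eq_one, hz]
  refine ⟨?_, ?_⟩
  · have := Subgroup.commutator_mem_commutator (Subgroup.mem_top z) (Subgroup.mem_top g)
    rwa [commutatorElement_def, hz] at this
  · rw [hz]
    simp only [mul_inv_rev, inv_inv, hz, mul_assoc]
    rw [← mul_assoc z z, hzz, one_mul]

theorem mk_central_of_inv_eq_self {z : G} (hz : z⁻¹ = z) (g : G ⧸ invertedSubgroup z) :
    QuotientGroup.mk' (invertedSubgroup z) z * g = g * QuotientGroup.mk' (invertedSubgroup z) z := by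
  obtain ⟨g, rfl⟩ := QuotientGroup.mk'_surjective _ g
  have h : QuotientGroup.mk' (invertedSubgroup z) (z * g * z * g⁻¹) = 1 :=
    (QuotientGroup.eq_one_iff _).mpr (conj_mul_inv_mem_invertedSubgroup hz g)
  rw [← map_mul, ← map_mul, show z * g = z * g * z * g⁻¹ * (g * z⁻¹) by group, map_mul, h, one_mul,
    hz]

theorem inv_eq_self_of_mul_mem {z x : G} (hz : z⁻¹ = z) (h : x * z ∈ invertedSubgroup z) :
    x⁻¹ = x := by
  have hzz : z * z = 1 := by rw [← inv_eq_iff_mul_eq_one, hz]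
  have := h.2
  rw [hz, mul_inv_rev, hz, mul_assoc, mul_assoc, hzz, mul_one] at this
  exact (mul_left_cancel this).symm

theorem central_of_inv_eq_self_of_mem_commutator {z : G} (hz : z⁻¹ = z) (hz1 : z ≠ 1)
    (hzG : z ∈ commutator G) (g : G) : z * g = g * z := by
  have hzz : z * z = 1 := by rw [← inv_eq_iff_mul_eq_one, hz]
  have hn : (Subgroup.zpowers z).Normal :=
    normal_of_le_commutator (Subgroup.zpowers_le.mpr hzG)
  rcases eq_one_or_eq_of_mem_zpowers hzz (hn.conj_mem z (Subgroup.mem_zpowers z) g) with h | h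
  · exact absurd (by simpa using h) hz1
  · exact (eq_mul_of_mul_inv_eq h).symm

variable [DecidableEq G] {X : Finset G}

theorem hasCayleyFlow_of_mul_mem_invertedSubgroup
    (h1 : (1 : G) ∉ X) (hinv : ∀ x ∈ X, x⁻¹ ∈ X) (hcard : X.card = 5)
    (hG : ∀ x ∈ X, x⁻¹ = x → x ∉ commutator G) {z a : G} (hzX : z ∈ X) (hz : z⁻¹ = z)
    (haX : a ∈ X) (ha : a⁻¹ = a) (hza : z ≠ a) (haz : a * z ∈ invertedSubgroup z) :
    HasCayleyFlow (MonoidHom.id G) X := by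
  have hsub : {z, a} ⊆ X := by simp [Finset.insert_subset_iff, hzX, haX]
  obtain ⟨b, hb, hbb⟩ := exists_inv_eq_self_of_odd_card
    (inv_mem_sdiff (Y := {z, a}) hinv (by simp [hz, ha]))
    (by rw [Finset.card_sdiff_of_subset hsub, hcard, Finset.card_pair hza]; decide)
  simp only [Finset.mem_sdiff, Finset.mem_insert, Finset.mem_singleton, not_or] at hb
  refine hasCayleyFlow_of_sdiff (Y := {z, a, b}) h1 hinv ?_ (by simp [hz, ha, hbb]) ?_ ?_
  · simp [Finset.insert_subset_iff, hzX, haX, hb.1]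
  · rw [hcard, Finset.card_eq_three.mpr ⟨z, a, b, hza, Ne.symm hb.2.1, Ne.symm hb.2.2, rfl⟩]
  · have hker : ∀ x ∈ X, x⁻¹ = x → QuotientGroup.mk' (invertedSubgroup z) x ≠ 1 :=
      fun x hx hxx h => hG x hx hxx ((QuotientGroup.eq_one_iff x).mp h).1
    refine (hasCayleyFlow_triple_of_map_eq (QuotientGroup.mk' (invertedSubgroup z)) hz ha hbb hza
      (Ne.symm hb.2.1) (Ne.symm hb.2.2) (mk_central_of_inv_eq_self hz) (hker z hzX hz)
      (hker b hb.1 hbb) ?_).toId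
    refine QuotientGroup.eq.mpr ?_
    rwa [ha]

variable [Finite G]

theorem hasCayleyFlow_of_mem_commutator
    (hX : Subgroup.closure (X : Set G) = ⊤) (h1 : (1 : G) ∉ X) (hinv : ∀ x ∈ X, x⁻¹ ∈ X)
    (hcard : X.card = 5) {z : G} (hzX : z ∈ X) (hz : z⁻¹ = z) (hzG : z ∈ commutator G) :
    HasCayleyFlow (MonoidHom.id G) X := by
  have hne : ∀ x ∈ X, x ≠ 1 := fun x hx h => h1 (h ▸ hx)
  have hzz : z * z = 1 := by rw [← inv_eq_iff_mul_eq_one, hz]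
  refine hasCayleyFlow_of_involution _ Function.surjective_id hX hinv hcard hzX hz (hne z hzX)
    (fun x _ _ => Or.inl ?_) (fun x hx _ => hne x hx) fun x _ h => h
  rw [central_of_inv_eq_self_of_mem_commutator hz (hne z hzX) hzG, mul_assoc, hzz, mul_one]

theorem hasCayleyFlow_of_disjoint_invertedSubgroup
    (hX : Subgroup.closure (X : Set G) = ⊤) (hinv : ∀ x ∈ X, x⁻¹ ∈ X) (hcard : X.card = 5)
    {z : G} (hzX : z ∈ X) (hz : z⁻¹ = z) (hdisj : ∀ x ∈ X, x ∉ invertedSubgroup z)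
    (hmul : ∀ a ∈ X, a⁻¹ = a → z ≠ a → a * z ∉ invertedSubgroup z) :
    HasCayleyFlow (MonoidHom.id G) X := by
  have hzz : z * z = 1 := by rw [← inv_eq_iff_mul_eq_one, hz]
  have hker : ∀ x ∈ X, QuotientGroup.mk' (invertedSubgroup z) x ≠ 1 :=
    fun x hx h => hdisj x hx ((QuotientGroup.eq_one_iff x).mp h)
  refine (hasCayleyFlow_of_involution (QuotientGroup.mk' (invertedSubgroup z))
    (QuotientGroup.mk'_surjective _) hX hinv hcard hzX hz (hker z hzX) (fun x _ _ => Or.inl ?_)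
    (fun x hx _ => hker x hx) fun x hx hxz h => ?_).toId
  · rw [map_mul, map_mul, mk_central_of_inv_eq_self hz, mul_assoc, ← map_mul, hzz, map_one, mul_one]
  · have h' : x * z ∈ invertedSubgroup z := by
      refine (QuotientGroup.eq_one_iff _).mp ?_
      change QuotientGroup.mk' (invertedSubgroup z) (x * z) = 1
      rw [map_mul, h, ← map_mul, hzz, map_one]
    exact hmul x hx (inv_eq_self_of_mul_mem hz h') hxz.symm h'

/-- Ladders exist modulo the subgroup of prime index `p` in `⟨κ⟩`. -/
theorem hasCayleyFlow_of_mem_zpowers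
    (hsq : Squarefree (Nat.card (commutator G))) {z x y κ : G} (hz : z⁻¹ = z) (hx : x⁻¹ ≠ x)
    (hy : y⁻¹ ≠ y) (hxy : x ≠ y) (hxy' : x⁻¹ ≠ y) (hzG : z ∉ commutator G)
    (hzy : z * y = y * κ * z) (hκ : κ ∈ invertedSubgroup z) (hyz : y ∉ invertedSubgroup z)
    (hxκ : x ∈ Subgroup.zpowers κ) :
    HasCayleyFlow (MonoidHom.id G) {z, x, x⁻¹, y, y⁻¹} := by
  have hzz : z * z = 1 := by rw [← inv_eq_iff_mul_eq_one, hz]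
  have hle : Subgroup.zpowers κ ≤ invertedSubgroup z := Subgroup.zpowers_le.mpr hκ
  have hsqκ : Squarefree (orderOf κ) := hsq.squarefree_of_dvd (by
    rw [← Nat.card_zpowers]; exact Subgroup.card_dvd_of_le (hle.trans fun _ h => h.1))
  obtain ⟨j, rfl⟩ := Subgroup.mem_zpowers_iff.mp hxκ
  have hdvd : orderOf (κ ^ j) ∣ orderOf κ := orderOf_dvd_of_mem_zpowers hxκ
  obtain ⟨p, hp, hpx, hpodd⟩ : ∃ p, p.Prime ∧ p ∣ orderOf (κ ^ j) ∧ Odd p := by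
    rcases Nat.eq_two_pow_or_exists_odd_prime_and_dvd (orderOf (κ ^ j)) with ⟨k, hk⟩ | h
    · refine absurd ?_ hx
      rw [inv_eq_iff_mul_eq_one, ← pow_two, ← orderOf_dvd_iff_pow_eq_one, hk]
      have h2 : Squarefree (2 ^ k) := hk ▸ hsqκ.squarefree_of_dvd hdvd
      have : k ≤ 1 := by
        by_contra! hk2
        have := h2 2 (by rw [← pow_two]; exact pow_dvd_pow 2 hk2)
        exact absurd this (by decide)
      exact (pow_dvd_pow 2 this).trans (by simp)
    · exact h
  have hpκ : p ∣ orderOf κ := hpx.trans hdvd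
  have hpj : ¬ (p : ℤ) ∣ j := by
    rintro ⟨i, rfl⟩
    obtain ⟨m, hm⟩ := hpκ
    have h1 : (κ ^ ((p : ℤ) * i)) ^ m = 1 := by
      rw [← zpow_natCast, ← zpow_mul, ← orderOf_dvd_iff_zpow_eq_one, hm]
      exact ⟨i, by push_cast; ring⟩
    have h2 : p ∣ m := hpx.trans (orderOf_dvd_of_pow_eq_one h1)
    have h3 := hsqκ p (by rw [hm]; exact mul_dvd_mul_left p h2)
    exact hp.one_lt.ne' (Nat.isUnit_iff.mp h3)
  have hM : Subgroup.zpowers (κ ^ p) ≤ Subgroup.zpowers κ :=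
    Subgroup.zpowers_le.mpr (pow_mem (Subgroup.mem_zpowers κ) p)
  have : (Subgroup.zpowers (κ ^ p)).Normal :=
    normal_of_le_commutator (hM.trans (hle.trans fun _ h => h.1))
  let φ := QuotientGroup.mk' (Subgroup.zpowers (κ ^ p))
  have hφ : ∀ g, φ g = 1 ↔ g ∈ Subgroup.zpowers (κ ^ p) := fun g => QuotientGroup.eq_one_iff g
  have hφκ : φ κ ^ (p : ℤ) = 1 := by
    rw [zpow_natCast, ← map_pow, hφ]; exact Subgroup.mem_zpowers _
  have hmem : ∀ g, φ g ∈ Subgroup.zpowers (φ (κ ^ j)) → g ∈ invertedSubgroup z := by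
    intro g hg
    obtain ⟨k, hk⟩ := Subgroup.mem_zpowers_iff.mp hg
    have h : φ (((κ ^ j) ^ k)⁻¹ * g) = 1 := by rw [map_mul, map_inv, map_zpow, hk, inv_mul_cancel]
    rw [hφ] at h
    have := mul_mem (zpow_mem (hle hxκ) k) (hle (hM h))
    rwa [mul_inv_cancel_left] at this
  let L : LadderSystem (G ⧸ Subgroup.zpowers (κ ^ p)) :=
    { ζ := φ z
      ξ := φ (κ ^ j)
      η := φ y
      κ := φ κ
      normal := by
        rw [← MonoidHom.map_zpowers]
        exact (normal_of_le_commutator ((Subgroup.zpowers_le.mpr hxκ).trans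
          (hle.trans fun _ h => h.1))).map φ (QuotientGroup.mk'_surjective _)
      mul_self := by rw [← map_mul, hzz, map_one]
      ζ_mul_ξ := by
        rw [← map_inv, ← map_mul, ← map_mul, ← (hle hxκ).2, inv_mul_cancel_right]
      ζ_mul_η := by rw [← map_mul, ← map_mul, ← map_mul, hzy]
      κ_mem := by
        have hcop : IsCoprime (p : ℤ) j :=
          (Nat.prime_iff_prime_int.mp hp).irreducible.coprime_iff_not_dvd.mpr hpj
        obtain ⟨u, v, huv⟩ := hcop
        refine Subgroup.mem_zpowers_iff.mpr ⟨v, ?_⟩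
        rw [map_zpow, ← zpow_mul, ← mul_one (φ κ ^ (j * v)), ← one_zpow u, ← hφκ, ← zpow_mul,
          ← zpow_add, show j * v + p * u = 1 by rw [← huv]; ring, zpow_one]
      κ_ne_one := by
        rw [Ne, hφ]
        intro h
        obtain ⟨m, hm⟩ := Subgroup.mem_zpowers_iff.mp h
        have h1 : κ ^ ((p : ℤ) * m - 1) = 1 := by
          rw [zpow_sub_one, zpow_mul, zpow_natCast, hm, mul_inv_cancel]
        have h2 : (p : ℤ) ∣ p * m - 1 :=
          (Int.natCast_dvd_natCast.mpr hpκ).trans (orderOf_dvd_iff_zpow_eq_one.mpr h1)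
        have h3 : (p : ℤ) ∣ 1 := (dvd_sub_right (dvd_mul_right _ m)).mp h2
        exact hp.one_lt.ne' (by exact_mod_cast Int.eq_one_of_dvd_one (by positivity) h3)
      odd_orderOf := by
        refine hpodd.of_dvd_nat (orderOf_dvd_of_pow_eq_one ?_)
        rw [map_zpow, ← zpow_natCast (φ κ ^ j), ← zpow_mul, mul_comm, zpow_mul, hφκ, one_zpow]
      ζ_notMem := fun h => hzG (hmem z h).1
      η_notMem := fun h => hyz (hmem y h)
      η_mul_ζ_notMem := fun h => hy (inv_eq_self_of_mul_mem hz (hmem _ (by rwa [map_mul]))) }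
  exact (L.hasCayleyFlow φ rfl rfl rfl hz hx hy hxy hxy').toId

theorem hasCayleyFlow_of_card_eq_five_of_closure_eq_top
    (hsq : Squarefree (Nat.card (commutator G)))
    (hX : Subgroup.closure (X : Set G) = ⊤) (h1 : (1 : G) ∉ X) (hinv : ∀ x ∈ X, x⁻¹ ∈ X)
    (hcard : X.card = 5) : HasCayleyFlow (MonoidHom.id G) X := by
  by_cases hG : ∀ x ∈ X, x⁻¹ = x → x ∉ commutator G
  swap
  · push Not at hG
    obtain ⟨z, hzX, hz, hzG⟩ := hG
    exact hasCayleyFlow_of_mem_commutator hX h1 hinv hcard hzX hz hzG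
  by_cases hmul : ∀ z ∈ X, z⁻¹ = z → ∀ a ∈ X, a⁻¹ = a → z ≠ a → a * z ∉ invertedSubgroup z
  swap
  · push Not at hmul
    obtain ⟨z, hzX, hz, a, haX, ha, hza, haz⟩ := hmul
    exact hasCayleyFlow_of_mul_mem_invertedSubgroup h1 hinv hcard hG hzX hz haX ha hza haz
  by_cases hmeet : ∀ z ∈ X, z⁻¹ = z → ∃ x ∈ X, x ∈ invertedSubgroup z
  swap
  · push Not at hmeet
    obtain ⟨z, hzX, hz, hdisj⟩ := hmeet
    exact hasCayleyFlow_of_disjoint_invertedSubgroup hX hinv hcard hzX hz hdisj (hmul z hzX hz)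
  obtain ⟨z, hzX, hz⟩ := exists_inv_eq_self_of_odd_card hinv (by rw [hcard]; decide)
  obtain ⟨x, hxX, hxz⟩ := hmeet z hzX hz
  have hzz : z * z = 1 := by rw [← inv_eq_iff_mul_eq_one, hz]
  have hx : x⁻¹ ≠ x := fun h => hG x hxX h hxz.1
  have hzx : z ≠ x := by rintro rfl; exact hx hz
  have hzx' : z ≠ x⁻¹ := by rintro rfl; exact hx (by simpa using hz.symm)
  have hsub : {z, x, x⁻¹} ⊆ X := by simp [Finset.insert_subset_iff, hzX, hxX, hinv x hxX]
  have hcard3 : ({z, x, x⁻¹} : Finset G).card = 3 :=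
    Finset.card_eq_three.mpr ⟨z, x, x⁻¹, hzx, hzx', hx.symm, rfl⟩
  have hunion := Finset.union_sdiff_of_subset hsub
  have hR := inv_mem_sdiff (Y := {z, x, x⁻¹}) hinv (by simp [hz])
  have hRcard : (X \ {z, x, x⁻¹}).card = 2 := by
    rw [Finset.card_sdiff_of_subset hsub, hcard, hcard3]
  rcases eq_pair_of_card_eq_two hR hRcard with ⟨y, hy, hXy⟩ | ⟨a, b, ha, hb, hab, hXab⟩
  · have hyR : y ∈ X \ {z, x, x⁻¹} := by rw [hXy]; simp
    simp only [Finset.mem_sdiff, Finset.mem_insert, Finset.mem_singleton, not_or] at hyR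
    obtain ⟨hyX, -, hyx, hyx'⟩ := hyR
    rw [hXy] at hunion
    obtain rfl : X = {z, x, x⁻¹, y, y⁻¹} := by rw [← hunion]; ext; simp; tauto
    obtain ⟨κ, hκ⟩ : ∃ κ, κ = y⁻¹ * z * y * z := ⟨_, rfl⟩
    have hκz : κ ∈ invertedSubgroup z := by
      have := inv_mem (conj_mul_inv_mem_invertedSubgroup hz y⁻¹)
      simpa only [hκ, mul_inv_rev, inv_inv, hz, mul_assoc] using this
    have hzy : z * y = y * κ * z := by rw [hκ]; simp [mul_assoc, hzz]
    have hconj : ∀ g ∈ invertedSubgroup z, z * g * z = g⁻¹ := fun g hg => by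
      simpa only [hz] using hg.2
    have hne : ∀ g ∈ ({z, x, x⁻¹, y, y⁻¹} : Finset G), g ≠ 1 := fun g hg h => h1 (h ▸ hg)
    by_cases hyz : y ∈ invertedSubgroup z
    · have hmem : ∀ g ∈ ({z, x, x⁻¹, y, y⁻¹} : Finset G), g ≠ z → g ∈ invertedSubgroup z := by
        intro g hg hgz
        simp only [Finset.mem_insert, Finset.mem_singleton] at hg
        rcases hg with rfl | rfl | rfl | rfl | rfl
        exacts [absurd rfl hgz, hxz, inv_mem hxz, hyz, inv_mem hyz]
      exact hasCayleyFlow_of_involution _ Function.surjective_id hX hinv hcard hzX hz (hne z hzX)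
        (fun g hg hgz => Or.inr (hconj g (hmem g hg hgz))) (fun g hg _ => hne g hg) fun _ _ h => h
    by_cases hxκ : x ∈ Subgroup.zpowers κ
    · exact hasCayleyFlow_of_mem_zpowers hsq hz hx hy (Ne.symm hyx) (Ne.symm hyx') (hG z hzX hz)
        hzy hκz hyz hxκ
    have hle : Subgroup.zpowers κ ≤ invertedSubgroup z := Subgroup.zpowers_le.mpr hκz
    have : (Subgroup.zpowers κ).Normal := normal_of_le_commutator (hle.trans fun _ h => h.1)
    have hker : ∀ g, QuotientGroup.mk' (Subgroup.zpowers κ) g = 1 ↔ g ∈ Subgroup.zpowers κ :=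
      fun g => QuotientGroup.eq_one_iff g
    have hker_z : ∀ g, QuotientGroup.mk' (Subgroup.zpowers κ) g =
        QuotientGroup.mk' (Subgroup.zpowers κ) z → g * z ∈ Subgroup.zpowers κ := fun g h => by
      rw [← hker, map_mul, h, ← map_mul, hzz, map_one]
    have hmul_z : ∀ g ∈ invertedSubgroup z, g * z ∉ Subgroup.zpowers κ := fun g hg h =>
      hG z hzX hz ((Subgroup.mul_mem_cancel_left _ hg.1).mp (hle h).1)
    have hzinv : ∀ g, z * g⁻¹ * z = (z * g * z)⁻¹ := fun g => by simp [mul_assoc, hz]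
    have hy_conj : QuotientGroup.mk' (Subgroup.zpowers κ) (z * y * z) =
        QuotientGroup.mk' (Subgroup.zpowers κ) y := by
      rw [hzy, mul_assoc, hzz, mul_one, map_mul, (hker κ).mpr (Subgroup.mem_zpowers κ), mul_one]
    refine (hasCayleyFlow_of_involution (QuotientGroup.mk' (Subgroup.zpowers κ))
      (QuotientGroup.mk'_surjective _) hX hinv hcard hzX hz ?_ ?_ ?_ ?_).toId
    · rw [Ne, hker]
      exact fun h => hG z hzX hz (hle h).1
    · intro g hg hgz
      simp only [Finset.mem_insert, Finset.mem_singleton] at hg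
      rcases hg with rfl | rfl | rfl | rfl | rfl
      · exact absurd rfl hgz
      · right; rw [hconj _ hxz, map_inv]
      · right; rw [hconj _ (inv_mem hxz), map_inv]
      · exact Or.inl hy_conj
      · left; rw [hzinv, map_inv, hy_conj, map_inv]
    · intro g hg hgz
      rw [Ne, hker]
      simp only [Finset.mem_insert, Finset.mem_singleton] at hg
      rcases hg with rfl | rfl | rfl | rfl | rfl
      · exact absurd rfl hgz
      · exact hxκ
      · rwa [inv_mem_iff]
      · exact fun h => hyz (hle h)
      · exact fun h => hyz (inv_mem_iff.mp (hle h))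
    · intro g hg hgz h
      replace h := hker_z g h
      simp only [Finset.mem_insert, Finset.mem_singleton] at hg
      rcases hg with rfl | rfl | rfl | rfl | rfl
      · exact hgz rfl
      · exact hmul_z _ hxz h
      · exact hmul_z _ (inv_mem hxz) h
      · exact hy (inv_eq_self_of_mul_mem hz (hle h))
      · exact hy (inv_injective (inv_eq_self_of_mul_mem hz (hle h)))
  · have hmem : ∀ g ∈ ({a, b} : Finset G), g ∈ X ∧ z ≠ g ∧ g * x * g⁻¹ = x⁻¹ := by
      intro g hg
      have hgg : g⁻¹ = g := by
        simp only [Finset.mem_insert, Finset.mem_singleton] at hg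
        rcases hg with rfl | rfl <;> assumption
      rw [← hXab] at hg
      simp only [Finset.mem_sdiff, Finset.mem_insert, Finset.mem_singleton, not_or] at hg
      refine ⟨hg.1, Ne.symm hg.2.1, ?_⟩
      obtain ⟨u, huX, hu⟩ := hmeet g hg.1 hgg
      have hux : u ∈ ({x, x⁻¹} : Finset G) := by
        have huz : u ≠ z := by rintro rfl; exact hG u hzX hz hu.1
        by_contra hux
        have huR : u ∈ X \ {z, x, x⁻¹} := by simpa [huX, huz] using hux
        rw [hXab] at huR
        simp only [Finset.mem_insert, Finset.mem_singleton] at huR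
        exact hG u huX (by rcases huR with rfl | rfl <;> assumption) hu.1
      simp only [Finset.mem_insert, Finset.mem_singleton] at hux
      rcases hux with rfl | rfl
      · exact hu.2
      · simpa using (inv_mem hu).2
    obtain ⟨haX, hza, hax⟩ := hmem a (by simp)
    obtain ⟨hbX, hzb, hbx⟩ := hmem b (by simp)
    refine hasCayleyFlow_of_sdiff (Y := {z, a, b}) h1 hinv ?_ (by simp [hz, ha, hb]) ?_
      (hasCayleyFlow_triple_of_conj_eq_inv hz ha hb hza hzb hab hx hxz.2 hax hbx)
    · simp [Finset.insert_subset_iff, hzX, haX, hbX]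
    · rw [hcard, Finset.card_eq_three.mpr ⟨z, a, b, hza, hzb, hab, rfl⟩]

end Main

section General

variable {G : Type*} [Group G] [DecidableEq G] {X : Finset G}

theorem exists_card_eq_two_of_card_ge_two (hinv : ∀ x ∈ X, x⁻¹ ∈ X) (hcard : 2 ≤ X.card) :
    ∃ Y ⊆ X, (∀ x ∈ Y, x⁻¹ ∈ Y) ∧ Y.card = 2 := by
  by_cases h : ∃ x ∈ X, x⁻¹ ≠ x
  · obtain ⟨x, hx, hxx⟩ := h
    exact ⟨{x, x⁻¹}, by simp [Finset.insert_subset_iff, hx, hinv x hx], by simp,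
      Finset.card_pair hxx.symm⟩
  · push Not at h
    obtain ⟨Y, hYX, hY⟩ := Finset.exists_subset_card_eq hcard
    exact ⟨Y, hYX, fun x hx => by rwa [h x (hYX hx)], hY⟩

variable [Finite G]

theorem hasCayleyFlow_of_card_eq_five (hsq : Squarefree (Nat.card (commutator G)))
    (h1 : (1 : G) ∉ X) (hinv : ∀ x ∈ X, x⁻¹ ∈ X) (hcard : X.card = 5) :
    HasCayleyFlow (MonoidHom.id G) X := by
  classical
  let S := Subgroup.closure (X : Set G)
  have hXS : ∀ x ∈ X, x ∈ S := fun x hx => Subgroup.subset_closure hx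
  have hmap : (X.subtype (· ∈ S)).map (Function.Embedding.subtype _) = X :=
    Finset.subtype_map_of_mem hXS
  have hsqS := hsq.squarefree_of_dvd (card_commutator_subgroup_dvd S)
  have := isCyclic_commutator_of_squarefree hsqS
  rw [← hmap]
  refine HasCayleyFlow.of_subgroup
    (hasCayleyFlow_of_card_eq_five_of_closure_eq_top hsqS ?_ ?_ ?_ ?_)
  · rw [show (X.subtype (· ∈ S) : Set S) = S.subtype ⁻¹' X by ext; simp]
    exact Subgroup.closure_closure_coe_preimage
  · simpa using h1
  · simpa using fun x _ hx => hinv x hx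
  · rw [← Finset.card_map (Function.Embedding.subtype _), hmap, hcard]

theorem hasCayleyFlow_of_four_le_card (hsq : Squarefree (Nat.card (commutator G)))
    (h1 : (1 : G) ∉ X) (hinv : ∀ x ∈ X, x⁻¹ ∈ X) (hcard : 4 ≤ X.card) :
    HasCayleyFlow (MonoidHom.id G) X := by
  induction hn : X.card using Nat.strong_induction_on generalizing X with
  | _ n ih =>
    by_cases h5 : X.card = 5
    · exact hasCayleyFlow_of_card_eq_five hsq h1 hinv h5
    obtain ⟨Y, hYX, hYinv, hY⟩ := exists_card_eq_two_of_card_ge_two hinv (by omega)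
    have hsd := inv_mem_sdiff hinv hYinv
    have hsd1 : (1 : G) ∉ X \ Y := fun h => h1 (Finset.mem_sdiff.mp h).1
    have hcard' := Finset.card_sdiff_of_subset hYX
    refine hasCayleyFlow_of_sdiff h1 hinv Finset.sdiff_subset hsd (by omega) ?_
    by_cases h4 : X.card = 4
    · exact hasCayleyFlow_of_card_eq_two hsd1 hsd (by omega)
    · exact ih _ (by omega) hsd1 hsd (by omega) rfl

end General

/-- Every Cayley graph of valency at least four on a finite group whose derived
subgroup has square-free order admits a nowhere-zero 3-flow. -/
theorem cayley_squarefree_commutator_nowhere_zero_3_flow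
    {G : Type*} [Group G] [Fintype G] [DecidableEq G]
    (hsq : Squarefree (Nat.card ↥(commutator G)))
    (X : Finset G) (h1 : (1 : G) ∉ X) (hinv : ∀ x ∈ X, x⁻¹ ∈ X)
    (hcard : 4 ≤ X.card) :
    HasNowhereZero3Flow (cayleyGraph (X : Set G)) := by
  exact (hasCayleyFlow_of_four_le_card hsq h1 hinv hcard).hasNowhereZero3Flow h1 hinv
end

section
/- Let Γ be a finite simple graph and let Γ₁, Γ₂, …, Γ_n (n ≥ 2) be subgraphs of Γ such that: (i) every edge of Γ is an edge of some Γᵢ; (ii) for each 1 ≤ i ≤ n, the graph Γᵢ admits a nowhere-zero 3-flow; and (iii) for each 2 ≤ l ≤ n, the union Γ₁ ∪ ⋯ ∪ Γ_{l-1} and Γ_l have at most one edge in common. Then Γ admits a nowhere-zero 3-flow. -/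
/-- `ReachIn f n x w`: there is a walk of length `n` from `x` to `w` along which `f` is positive. -/
def ReachIn {V : Type*} (f : V → V → ℤ) : ℕ → V → V → Prop
  | 0, x, w => x = w
  | n + 1, x, w => ∃ y, 0 < f x y ∧ ReachIn f n y w

theorem ReachIn.of_pos_imp {V : Type*} {f f' : V → V → ℤ} {x w : V}
    (h : ∀ a b, a ≠ x → 0 < f a b → 0 < f' a b) (n : ℕ) (y : V)
    (hx : ∀ k ≤ n, ¬ ReachIn f k x w) (hy : ReachIn f n y w) : ReachIn f' n y w := by
  induction n generalizing y with
  | zero => exact hy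
  | succ n ih =>
    obtain ⟨z, hz, hr⟩ := hy
    refine ⟨z, h y z ?_ hz, ih z (fun k hk => hx k (by omega)) hr⟩
    rintro rfl
    exact hx (n + 1) le_rfl ⟨z, hz, hr⟩

/-- Antisymmetric functions supported on the edges of `G` with values `±1`, `±2` on them. -/
structure IsPreflow {V : Type*} (G : SimpleGraph V) (f : V → V → ℤ) : Prop where
  antisymm : ∀ u v, f u v = - f v u
  support : ∀ u v, ¬ G.Adj u v → f u v = 0
  range : ∀ u v, G.Adj u v → 0 < |f u v| ∧ |f u v| < 3

/-- Decreasing a preflow by `3` on a positive edge. -/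
theorem IsPreflow.exists_push {V : Type*} [Fintype V] [DecidableEq V] {G : SimpleGraph V}
    {f : V → V → ℤ} (hf : IsPreflow G f) {x y : V} (hxy : 0 < f x y) :
    ∃ f', IsPreflow G f' ∧ (∀ a b, a ≠ x → 0 < f a b → 0 < f' a b) ∧
      ∀ u, ∑ v, f' u v = ∑ v, f u v - (if u = x then 3 else 0) + if u = y then 3 else 0 := by
  have hadj : G.Adj x y := by
    by_contra h
    have := hf.support x y h
    omega
  have hne : x ≠ y := hadj.ne
  have hr := hf.range x y hadj
  have ha := hf.antisymm x y
  refine ⟨fun u v => f u v - (if u = x then (if v = y then 3 else 0) else 0)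
    + (if u = y then (if v = x then 3 else 0) else 0), ⟨?_, ?_, ?_⟩, ?_, ?_⟩
  · intro u v
    have := hf.antisymm u v
    split_ifs <;> omega
  · intro u v huv
    have h1 : ¬ (u = x ∧ v = y) := by rintro ⟨rfl, rfl⟩; exact huv hadj
    have h2 : ¬ (u = y ∧ v = x) := by rintro ⟨rfl, rfl⟩; exact huv hadj.symm
    have := hf.support u v huv
    split_ifs <;> simp_all
  · intro u v huv
    have := hf.range u v huv
    rw [abs_pos, abs_lt] at *
    split_ifs <;> subst_vars <;> first | contradiction | omega
  · intro a b hax hab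
    simp only [if_neg hax]
    split_ifs <;> omega
  · intro u
    simp only [Finset.sum_add_distrib, Finset.sum_sub_distrib]
    congr 2
    · split_ifs <;> simp
    · split_ifs <;> simp

/-- Decreasing a preflow by `3` along a positive walk. -/
theorem IsPreflow.exists_push_of_reachIn {V : Type*} [Fintype V] [DecidableEq V]
    {G : SimpleGraph V} {w : V} (n : ℕ) {f : V → V → ℤ} (hf : IsPreflow G f) {x : V}
    (h : ReachIn f n x w) :
    ∃ f', IsPreflow G f' ∧
      ∀ u, ∑ v, f' u v = ∑ v, f u v - (if u = x then 3 else 0) + if u = w then 3 else 0 := by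
  induction n using Nat.strong_induction_on generalizing f x with
  | _ n ih =>
    by_cases hshort : ∃ k < n, ReachIn f k x w
    · obtain ⟨k, hk, hr⟩ := hshort
      exact ih k hk hf hr
    push Not at hshort
    cases n with
    | zero =>
      obtain rfl : x = w := h
      exact ⟨f, hf, fun u => by ring⟩
    | succ n =>
      obtain ⟨y, hxy, hr⟩ := h
      obtain ⟨g, hg, hpos, hsum⟩ := hf.exists_push hxy
      have hr' : ReachIn g n y w :=
        ReachIn.of_pos_imp hpos n y (fun k hk => hshort k (by omega)) hr
      obtain ⟨f', hf', hsum'⟩ := ih n (by omega) hg hr'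
      exact ⟨f', hf', fun u => by rw [hsum', hsum]; ring⟩

theorem sum_sum_eq_zero_of_antisymm {V : Type*} {f : V → V → ℤ}
    (hf : ∀ u v, f u v = - f v u) (S : Finset V) : ∑ u ∈ S, ∑ v ∈ S, f u v = 0 := by
  have h : ∑ u ∈ S, ∑ v ∈ S, f u v = - ∑ u ∈ S, ∑ v ∈ S, f u v := by
    conv_lhs => rw [Finset.sum_comm]
    simp only [← Finset.sum_neg_distrib]
    exact Finset.sum_congr rfl fun u _ => Finset.sum_congr rfl fun v _ => hf v u
  omega

/-- A vertex with negative net outflow is reached, along positive edges, from one with positive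
net outflow. -/
theorem exists_reachIn_of_sum_neg {V : Type*} [Fintype V] {f : V → V → ℤ}
    (hf : ∀ u v, f u v = - f v u) {w : V} (hw : ∑ v, f w v < 0) :
    ∃ x n, ReachIn f n x w ∧ 0 < ∑ v, f x v := by
  classical
  by_contra! hcon
  let S : Finset V := Finset.univ.filter fun x => ∃ n, ReachIn f n x w
  have hS : ∀ x, x ∈ S ↔ ∃ n, ReachIn f n x w := fun x => by simp [S]
  have hneg : ∑ u ∈ S, ∑ v, f u v < 0 := by
    refine Finset.sum_neg' (fun u hu => ?_) ⟨w, (hS w).2 ⟨0, rfl⟩, hw⟩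
    obtain ⟨n, hn⟩ := (hS u).1 hu
    exact hcon u n hn
  have hsplit : ∑ u ∈ S, ∑ v, f u v = ∑ u ∈ S, ∑ v ∈ Sᶜ, f u v := by
    rw [← zero_add (∑ u ∈ S, ∑ v ∈ Sᶜ, f u v), ← sum_sum_eq_zero_of_antisymm hf S,
      ← Finset.sum_add_distrib]
    exact Finset.sum_congr rfl fun u _ => (Finset.sum_add_sum_compl S _).symm
  have hnonneg : 0 ≤ ∑ u ∈ S, ∑ v ∈ Sᶜ, f u v := by
    refine Finset.sum_nonneg fun u hu => Finset.sum_nonneg fun v hv => ?_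
    by_contra! hlt
    obtain ⟨n, hn⟩ := (hS u).1 hu
    refine Finset.mem_compl.1 hv ((hS v).2 ⟨n + 1, u, ?_, hn⟩)
    have := hf u v
    omega
  omega

/-- A preflow conserved modulo `3` can be turned into a nowhere-zero `3`-flow. -/
theorem IsPreflow.hasNowhereZero3Flow {V : Type*} [Fintype V] {G : SimpleGraph V}
    {f : V → V → ℤ} (hf : IsPreflow G f) (hmod : ∀ u, (3 : ℤ) ∣ ∑ v, f u v) :
    HasNowhereZero3Flow G := by
  classical
  induction hm : ∑ u, (∑ v, f u v).natAbs using Nat.strong_induction_on generalizing f with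
  | _ m ih =>
    by_cases hneg : ∃ w, ∑ v, f w v < 0
    · obtain ⟨w, hw⟩ := hneg
      obtain ⟨x, n, hr, hx⟩ := exists_reachIn_of_sum_neg hf.antisymm hw
      obtain ⟨f', hf', hsum⟩ := hf.exists_push_of_reachIn n hr
      have hxw : x ≠ w := by rintro rfl; omega
      refine ih _ ?_ hf' (fun u => ?_) rfl
      · rw [← hm]
        refine Finset.sum_lt_sum (fun u _ => ?_) ⟨x, Finset.mem_univ x, ?_⟩
        · have := hmod u
          rw [hsum]
          split_ifs <;> subst_vars <;> omega
        · have := hmod x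
          rw [hsum, if_pos rfl, if_neg hxw]
          omega
      · have := hmod u
        rw [hsum]
        split_ifs <;> omega
    · push Not at hneg
      refine ⟨f, hf.antisymm, hf.support, hf.range, fun u => ?_⟩
      exact (Finset.sum_eq_zero_iff_of_nonneg fun i _ => hneg i).1
        (sum_sum_eq_zero_of_antisymm hf.antisymm Finset.univ) u (Finset.mem_univ u)

/-- A nowhere-zero flow modulo `3` yields a nowhere-zero `3`-flow. -/
theorem hasNowhereZero3Flow_of_mod_three {V : Type*} [Fintype V] {G : SimpleGraph V}
    {f : V → V → ℤ} (hanti : ∀ u v, f u v = - f v u) (hsupp : ∀ u v, ¬ G.Adj u v → f u v = 0)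
    (hne : ∀ u v, G.Adj u v → ¬ (3 : ℤ) ∣ f u v) (hmod : ∀ u, (3 : ℤ) ∣ ∑ v, f u v) :
    HasNowhereZero3Flow G := by
  have hpre : IsPreflow G fun u v => (f u v + 1) % 3 - 1 := by
    refine ⟨fun u v => ?_, fun u v h => ?_, fun u v h => ?_⟩
    · have := hanti u v
      omega
    · simp [hsupp u v h]
    · have := hne u v h
      rw [abs_pos, abs_lt]
      omega
  refine hpre.hasNowhereZero3Flow fun u => ?_
  have hdiff : (3 : ℤ) ∣ ∑ v, (f u v - ((f u v + 1) % 3 - 1)) :=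
    Finset.dvd_sum fun v _ => by omega
  rw [Finset.sum_sub_distrib] at hdiff
  exact (dvd_sub_right (hmod u)).1 hdiff

theorem HasNowhereZero3Flow.sup {V : Type*} [Fintype V] {A B : SimpleGraph V}
    (hA : HasNowhereZero3Flow A) (hB : HasNowhereZero3Flow B)
    (hAB : (A ⊓ B).edgeSet.Subsingleton) : HasNowhereZero3Flow (A ⊔ B) := by
  obtain ⟨f, hfa, hfs, hfr, hf⟩ := hA
  obtain ⟨g, hga, hgs, hgr, hg⟩ := hB
  simp only [abs_pos, abs_lt] at hfr hgr
  have hsign : ∃ s : ℤ, (s = 1 ∨ s = -1) ∧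
      ∀ u v, A.Adj u v → B.Adj u v → ¬ (3 : ℤ) ∣ f u v + s * g u v := by
    by_cases hcom : ∃ a b, A.Adj a b ∧ B.Adj a b
    · obtain ⟨a, b, hab, hab'⟩ := hcom
      have hf1 := hfr a b hab
      have hg1 := hgr a b hab'
      obtain ⟨s, hs, hsab⟩ : ∃ s : ℤ, (s = 1 ∨ s = -1) ∧ ¬ (3 : ℤ) ∣ f a b + s * g a b := by
        by_cases h : (3 : ℤ) ∣ f a b + g a b
        · exact ⟨-1, by simp, by omega⟩
        · exact ⟨1, by simp, by omega⟩
      refine ⟨s, hs, fun u v hu hu' => ?_⟩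
      have he : s(u, v) = s(a, b) :=
        hAB (show (A ⊓ B).Adj u v from ⟨hu, hu'⟩) (show (A ⊓ B).Adj a b from ⟨hab, hab'⟩)
      rcases Sym2.eq_iff.1 he with ⟨rfl, rfl⟩ | ⟨rfl, rfl⟩
      · exact hsab
      · have := hfa u v
        have := hga u v
        rcases hs with rfl | rfl <;> omega
    · push Not at hcom
      exact ⟨1, by simp, fun u v hu hu' => absurd hu' (hcom u v hu)⟩
  obtain ⟨s, hs, hsne⟩ := hsign
  refine hasNowhereZero3Flow_of_mod_three (f := fun u v => f u v + s * g u v)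
    (fun u v => ?_) (fun u v h => ?_) (fun u v h => ?_) (fun u => ?_)
  · rw [hfa u v, hga u v]
    ring
  · rw [SimpleGraph.sup_adj, not_or] at h
    simp [hfs u v h.1, hgs u v h.2]
  · by_cases hu : A.Adj u v
    · by_cases hu' : B.Adj u v
      · exact hsne u v hu hu'
      · have := hfr u v hu
        simp only [hgs u v hu', mul_zero]
        omega
    · have hu' := h.resolve_left hu
      have := hgr u v hu'
      simp only [hfs u v hu]
      rcases hs with rfl | rfl <;> omega
  · simp [Finset.sum_add_distrib, ← Finset.mul_sum, hf, hg]


/-- If a finite simple graph `Γ` is the union of `n ≥ 2` subgraphs `Γ₀, …, Γ_{n-1}`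
(every edge of `Γ` lies in some `Γᵢ`), each admitting a nowhere-zero 3-flow, and for
each `l ≥ 1` the union `Γ₀ ∪ ⋯ ∪ Γ_{l-1}` has at most one edge in common with `Γ_l`,
then `Γ` admits a nowhere-zero 3-flow. -/
theorem union_nowhere_zero_3_flow {V : Type*} [Fintype V]
    (Γ : SimpleGraph V) (n : ℕ) (hn : 2 ≤ n)
    (Γs : Fin n → SimpleGraph V)
    (hle : ∀ i, Γs i ≤ Γ)
    (hcover : ∀ u v, Γ.Adj u v → ∃ i, (Γs i).Adj u v)
    (hflow : ∀ i, HasNowhereZero3Flow (Γs i))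
    (hcommon : ∀ l : Fin n, 0 < l.1 →
      Set.Subsingleton (((⨆ i, ⨆ (_ : i < l), Γs i) ⊓ Γs l).edgeSet)) :
    HasNowhereZero3Flow Γ := by
  have key : ∀ l ≤ n, HasNowhereZero3Flow (⨆ i : Fin n, ⨆ (_ : i.1 < l), Γs i) := by
    intro l
    induction l with
    | zero => exact fun _ => ⟨fun _ _ => 0, by simp⟩
    | succ l ih =>
      intro hl
      have hstep : (⨆ i : Fin n, ⨆ (_ : i.1 < l + 1), Γs i) =
          (⨆ i : Fin n, ⨆ (_ : i.1 < l), Γs i) ⊔ Γs ⟨l, hl⟩ := by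
        apply le_antisymm
        · refine iSup₂_le fun i hi => ?_
          rcases Nat.lt_succ_iff_lt_or_eq.1 hi with h | h
          · exact le_sup_of_le_left (le_iSup₂_of_le i h le_rfl)
          · obtain rfl : i = ⟨l, hl⟩ := Fin.ext h
            exact le_sup_right
        · exact sup_le (iSup₂_le fun i hi => le_iSup₂_of_le i (Nat.lt_succ_of_lt hi) le_rfl)
            (le_iSup₂_of_le ⟨l, hl⟩ (Nat.lt_succ_self l) le_rfl)
      rw [hstep]
      refine (ih (by omega)).sup (hflow _) ?_
      rcases Nat.eq_zero_or_pos l with rfl | hpos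
      · simp
      · exact hcommon ⟨l, hl⟩ hpos
  have hΓ : (⨆ i : Fin n, ⨆ (_ : i.1 < n), Γs i) = Γ := by
    apply le_antisymm (iSup₂_le fun i _ => hle i)
    intro u v huv
    obtain ⟨i, hi⟩ := hcover u v huv
    exact le_iSup₂_of_le (f := fun (i : Fin n) (_ : i.1 < n) => Γs i) i i.2 le_rfl hi
  exact hΓ ▸ key n le_rfl
end

section
/- Let Γ be a finite simple graph that is regular of odd valency d, and let H be a spanning subgraph of Γ (a graph on the same vertex set with every edge of H an edge of Γ) that is regular of odd valency d' and admits a nowhere-zero 3-flow. Then Γ admits a nowhere-zero 3-flow. -/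
namespace SimpleGraph

open scoped Classical in
/-- The unit flow along a walk: each traversal of an edge contributes `1` in the direction of
travel and `-1` in the opposite direction. -/
noncomputable def Walk.unitFlow {V : Type*} {G : SimpleGraph V} :
    {u v : V} → G.Walk u v → V → V → ℤ
  | _, _, .nil => fun _ _ => 0
  | _, _, .cons (u := u) (v := v) _ p => fun a b =>
      (if a = u ∧ b = v then 1 else 0) - (if a = v ∧ b = u then 1 else 0) + p.unitFlow a b

namespace Walk

variable {V : Type*} {G : SimpleGraph V}

lemma unitFlow_antisymm {u v : V} (p : G.Walk u v) (a b : V) :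
    p.unitFlow a b = -p.unitFlow b a := by
  induction p with
  | nil => simp [unitFlow]
  | cons h p ih =>
    simp only [unitFlow, ih]
    grind

lemma unitFlow_eq_zero {u v : V} (p : G.Walk u v) {a b : V} (h : s(a, b) ∉ p.edges) :
    p.unitFlow a b = 0 := by
  induction p with
  | nil => simp [unitFlow]
  | cons hadj p ih =>
    simp only [edges_cons, List.mem_cons, not_or, Sym2.eq_iff] at h
    simp only [unitFlow, ih h.2]
    grind

lemma IsTrail.abs_unitFlow_eq_one {u v : V} {p : G.Walk u v} (hp : p.IsTrail) {a b : V}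
    (h : s(a, b) ∈ p.edges) : |p.unitFlow a b| = 1 := by
  induction p with
  | nil => simp at h
  | @cons u v w hadj p ih =>
    rw [isTrail_cons] at hp
    by_cases hab : s(a, b) = s(u, v)
    · have hzero := p.unitFlow_eq_zero (hab ▸ hp.2)
      have hne := hadj.ne
      rw [Sym2.eq_iff] at hab
      simp only [unitFlow, hzero]
      rcases hab with ⟨rfl, rfl⟩ | ⟨rfl, rfl⟩ <;> simp [hne, hne.symm]
    · have hmem : s(a, b) ∈ p.edges := by simpa [hab] using h
      have hone := ih hp.1 hmem
      rw [Sym2.eq_iff] at hab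
      push Not at hab
      have h1 : ¬(a = u ∧ b = v) := fun h => hab.1 h.1 h.2
      have h2 : ¬(a = v ∧ b = u) := fun h => hab.2 h.1 h.2
      simpa [unitFlow, h1, h2] using hone

open scoped Classical in
lemma sum_unitFlow [Fintype V] {u v : V} (p : G.Walk u v) (a : V) :
    ∑ b, p.unitFlow a b = (if a = u then 1 else 0) - (if a = v then 1 else 0) := by
  induction p with
  | nil => simp [unitFlow]
  | cons h p ih =>
    simp [unitFlow, Finset.sum_add_distrib, ih, ite_and]

end Walk

variable {V : Type*} [Fintype V]

open scoped Classical in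
/-- A longest trail in a graph with all degrees even is closed. -/
lemma exists_closed_isTrail_of_even_degree {G : SimpleGraph V} (heven : ∀ v, Even (G.degree v))
    (hG : G ≠ ⊥) : ∃ (u : V) (p : G.Walk u u), p.IsTrail ∧ 0 < p.length := by
  obtain ⟨x, y, hxy⟩ := G.ne_bot_iff_exists_adj.mp hG
  let S : Set ℕ := {n | ∃ (u v : V) (p : G.Walk u v), p.IsTrail ∧ p.length = n}
  have hone : 1 ∈ S := ⟨x, y, hxy.toWalk, by simp [Walk.isTrail_def], by simp⟩
  have hbdd : BddAbove S := by
    refine ⟨G.edgeFinset.card, ?_⟩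
    rintro _ ⟨u, v, p, hp, rfl⟩
    exact hp.length_le_card_edgeFinset
  obtain ⟨u, v, p, hp, hlen⟩ := Nat.sSup_mem ⟨1, hone⟩ hbdd
  have hpos : 0 < p.length := hlen ▸ le_csSup hbdd hone
  by_cases huv : v = u
  · subst huv
    exact ⟨v, p, hp, hpos⟩
  exfalso
  have hall : ∀ w, G.Adj w v → s(w, v) ∈ p.edges := by
    intro w hw
    by_contra hnot
    have hlonger : (Walk.cons hw p.reverse).length ∈ S :=
      ⟨w, u, _, (Walk.isTrail_cons ..).mpr ⟨hp.reverse, by simpa using hnot⟩, rfl⟩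
    have := le_csSup hbdd hlonger
    simp only [Walk.length_cons, Walk.length_reverse] at this
    omega
  have hcount : p.edges.countP (v ∈ ·) = G.degree v := by
    rw [← G.card_incidenceFinset_eq_degree, List.countP_eq_length_filter,
      ← List.toFinset_card_of_nodup (hp.edges_nodup.filter _)]
    congr 1
    ext e
    induction e with | _ a b
    simp only [List.mem_toFinset, List.mem_filter, decide_eq_true_eq, mem_incidenceFinset,
      incidenceSet, Set.mem_ofPred_eq, mem_edgeSet]
    constructor
    · exact fun h => ⟨p.adj_of_mem_edges h.1, h.2⟩
    · rintro ⟨hab, hv⟩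
      refine ⟨?_, hv⟩
      rcases Sym2.mem_iff.mp hv with rfl | rfl
      · exact Sym2.eq_swap ▸ hall b hab.symm
      · exact hall a hab
  have := (hp.even_countP_edges_iff v).mp (hcount ▸ heven v) (Ne.symm huv)
  exact this.2 rfl

open scoped Classical in
/-- A graph all of whose degrees are even has a flow taking only the values `1` and `-1` on
its edges. -/
lemma exists_unit_flow_of_even_degree (G : SimpleGraph V) (heven : ∀ v, Even (G.degree v)) :
    ∃ f : V → V → ℤ, (∀ u v, f u v = -f v u) ∧ (∀ u v, ¬G.Adj u v → f u v = 0) ∧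
      (∀ u v, G.Adj u v → |f u v| = 1) ∧ ∀ u, ∑ v, f u v = 0 := by
  induction G using WellFoundedLT.induction with | ind G ih
  by_cases hG : G = ⊥
  · subst hG
    exact ⟨fun _ _ => 0, by simp⟩
  obtain ⟨x, p, hp, hpos⟩ := exists_closed_isTrail_of_even_degree heven hG
  have hsum : ∀ u, ∑ v, p.unitFlow u v = 0 := fun u => by simp [p.sum_unitFlow]
  obtain ⟨G', hadj⟩ : ∃ G' : SimpleGraph V, ∀ u v, G'.Adj u v ↔ G.Adj u v ∧ s(u, v) ∉ p.edges :=
    ⟨G.deleteEdges {e | e ∈ p.edges}, fun u v => by simp [deleteEdges_adj]⟩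
  have hlt : G' < G := by
    refine lt_of_le_of_ne (fun u v h => ((hadj u v).mp h).1) fun heq => ?_
    obtain ⟨e, he⟩ := List.exists_mem_of_length_pos (p.length_edges.symm ▸ hpos)
    induction e with | _ a b
    exact ((hadj a b).mp (heq ▸ p.adj_of_mem_edges he)).2 he
  have heven' : ∀ u, Even (G'.degree u) := by
    intro u
    have hterm : ∀ v, (((if G'.Adj u v then 1 else 0 : ℕ) : ℤ) : ZMod 2) =
        ((if G.Adj u v then 1 else 0 : ℕ) : ZMod 2) + (p.unitFlow u v : ZMod 2) := by
      intro v
      by_cases hmem : s(u, v) ∈ p.edges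
      · have h1 := p.adj_of_mem_edges hmem
        have h2 : ¬G'.Adj u v := fun h => ((hadj u v).mp h).2 hmem
        rcases eq_or_eq_neg_of_abs_eq (hp.abs_unitFlow_eq_one hmem) with h | h <;>
          simp [h, h1, h2] <;> decide
      · simp [p.unitFlow_eq_zero hmem, hadj, hmem]
    have hdeg : ∀ K : SimpleGraph V, K.degree u = ∑ v, if K.Adj u v then 1 else 0 := fun K => by
      rw [← card_neighborFinset_eq_degree, neighborFinset_eq_filter, Finset.card_filter]
    have hcast : ((G'.degree u : ℕ) : ZMod 2) = (G.degree u : ℕ) := by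
      have := Finset.sum_congr (rfl : (Finset.univ : Finset V) = _) fun v _ => hterm v
      rw [Finset.sum_add_distrib, ← Int.cast_sum, ← Int.cast_sum, hsum u] at this
      rw [hdeg G', hdeg G]
      simpa using this
    rw [← ZMod.natCast_eq_zero_iff_even, hcast, ZMod.natCast_eq_zero_iff_even]
    exact heven u
  obtain ⟨f, hanti, hzero, hone, hf⟩ := ih G' hlt heven'
  refine ⟨fun u v => f u v + p.unitFlow u v, fun u v => ?_, fun u v h => ?_, fun u v h => ?_,
    fun u => by rw [Finset.sum_add_distrib, hf, hsum, add_zero]⟩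
  · beta_reduce
    rw [hanti, p.unitFlow_antisymm]
    ring
  · beta_reduce
    rw [hzero u v fun h' => h (hlt.le h'), p.unitFlow_eq_zero fun h' => h (p.adj_of_mem_edges h'),
      add_zero]
  · beta_reduce
    by_cases hmem : s(u, v) ∈ p.edges
    · rw [hzero u v fun h' => ((hadj u v).mp h').2 hmem, zero_add]
      exact hp.abs_unitFlow_eq_one hmem
    · rw [p.unitFlow_eq_zero hmem, add_zero]
      exact hone u v ((hadj u v).mpr ⟨h, hmem⟩)

end SimpleGraph

/-- A regular graph of odd valency having a regular spanning subgraph of odd valency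
which admits a nowhere-zero 3-flow itself admits a nowhere-zero 3-flow. -/
theorem regular_spanning_subgraph_nowhere_zero_3_flow {V : Type*} [Fintype V]
    (Γ H : SimpleGraph V) [DecidableRel Γ.Adj] [DecidableRel H.Adj]
    (d d' : ℕ) (hd : Odd d) (hd' : Odd d')
    (hreg : Γ.IsRegularOfDegree d)
    (hsub : H ≤ Γ)
    (hreg' : H.IsRegularOfDegree d')
    (hH : HasNowhereZero3Flow H) :
    HasNowhereZero3Flow Γ := by
  classical
  have heven : ∀ v, Even ((Γ \ H).degree v) := by
    intro v
    have hcard : (Γ \ H).degree v = d - d' := by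
      rw [← hreg.degree_eq v, ← hreg'.degree_eq v, ← SimpleGraph.card_neighborFinset_eq_degree,
        ← SimpleGraph.card_neighborFinset_eq_degree, ← SimpleGraph.card_neighborFinset_eq_degree,
        ← Finset.card_sdiff_of_subset]
      · congr 1
        ext w
        simp
      · intro w
        simpa using fun h => hsub h
    rw [hcard]
    exact Nat.Odd.sub_odd hd hd'
  obtain ⟨f, hf_anti, hf_zero, hf_one, hf_sum⟩ :=
    (Γ \ H).exists_unit_flow_of_even_degree fun v => by convert heven v
  obtain ⟨g, hg_anti, hg_zero, hg_bound, hg_sum⟩ := hH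
  refine ⟨fun u v => f u v + g u v, fun u v => ?_, fun u v h => ?_, fun u v h => ?_,
    fun u => by rw [Finset.sum_add_distrib, hf_sum, hg_sum, add_zero]⟩
  · beta_reduce
    rw [hf_anti, hg_anti]
    ring
  · beta_reduce
    rw [hf_zero u v fun h' => h h'.1, hg_zero u v fun h' => h (hsub h'), add_zero]
  · beta_reduce
    by_cases hadj : H.Adj u v
    · rw [hf_zero u v fun h' => h'.2 hadj, zero_add]
      exact hg_bound u v hadj
    · rw [hg_zero u v hadj, add_zero, hf_one u v ⟨h, hadj⟩]
      norm_num
end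

section
/- Let Γ be a finite simple graph that is regular of odd valency, and suppose Γ has a spanning subgraph H (a graph on the same vertex set with every edge of H an edge of Γ) that is 3-regular and bipartite. Then Γ admits a nowhere-zero 3-flow. -/
open Finset in
/-- A finite regular graph of positive valency admits an injective choice of neighbours. -/
theorem SimpleGraph.IsRegularOfDegree.exists_injective_adj {V : Type*} [Fintype V]
    {G : SimpleGraph V} [DecidableRel G.Adj] {d : ℕ} (hG : G.IsRegularOfDegree d) (hd : 0 < d) :
    ∃ m : V → V, Function.Injective m ∧ ∀ u, G.Adj u (m u) := by
  classical
  obtain ⟨m, hm, hadj⟩ :=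
    (Finset.all_card_le_biUnion_card_iff_exists_injective fun u => G.neighborFinset u).1 fun S => by
      refine le_of_mul_le_mul_right (card_mul_le_card_mul G.Adj (m := d) (n := d) ?_ ?_) hd
      · intro a ha
        rw [← hG a, ← G.card_neighborFinset_eq_degree]
        refine card_le_card fun b hb => ?_
        simp only [bipartiteAbove, mem_filter, mem_biUnion]
        exact ⟨⟨a, ha, hb⟩, by simpa using hb⟩
      · intro b _
        rw [← hG b, ← G.card_neighborFinset_eq_degree]
        refine card_le_card fun a ha => ?_
        simpa [bipartiteBelow, G.adj_comm b a] using (mem_filter.1 ha).2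
  exact ⟨m, hm, fun u => by simpa using hadj u⟩

open Finset in
/-- The edges of a finite graph that is regular of valency `2 * k` can be assigned to their
endpoints, with labels in `Fin k`, so that distinct edges get distinct labelled endpoints. -/
theorem SimpleGraph.IsRegularOfDegree.exists_injective_edge_endpoint {V : Type*} [Fintype V]
    {G : SimpleGraph V} [DecidableRel G.Adj] {k : ℕ} (hG : G.IsRegularOfDegree (2 * k)) :
    ∃ φ : G.edgeSet → V × Fin k, Function.Injective φ ∧ ∀ e, (φ e).1 ∈ e.1 := by
  classical
  obtain ⟨φ, hφ, hmem⟩ :=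
    (Finset.all_card_le_biUnion_card_iff_exists_injective
      fun e : G.edgeSet => ({v | v ∈ e.1} : Finset V) ×ˢ (univ : Finset (Fin k))).1 fun S => by
      set T : Finset V := {v | ∃ e ∈ S, v ∈ e.1} with hT
      have hU : (S.biUnion fun e => ({v | v ∈ e.1} : Finset V) ×ˢ (univ : Finset (Fin k)))
          = T ×ˢ univ := by
        ext p
        simp [hT]
      rw [hU, card_product, card_univ, Fintype.card_fin]
      have key : #S * 2 ≤ #T * (2 * k) := by
        refine card_mul_le_card_mul (fun (e : G.edgeSet) v => v ∈ e.1) ?_ ?_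
        · rintro ⟨e, he⟩ heS
          induction e with
          | _ a b =>
            rw [SimpleGraph.mem_edgeSet] at he
            rw [← card_pair he.ne]
            refine card_le_card fun x hx => ?_
            have hx' : x ∈ s(a, b) := by simpa using hx
            exact mem_filter.2 ⟨mem_filter.2 ⟨mem_univ _, _, heS, hx'⟩, hx'⟩
        · intro v _
          rw [← hG v, ← G.card_incidenceFinset_eq_degree]
          refine card_le_card_of_injOn Subtype.val (fun e he => ?_) Subtype.val_injective.injOn
          have := (mem_filter.1 he).2
          simpa [SimpleGraph.incidenceSet] using this
      linarith
  exact ⟨φ, hφ, fun e => by simpa using hmem e⟩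

open Finset in
/-- A finite regular graph of even valency admits a flow with values `±1` on its edges. -/
theorem SimpleGraph.IsRegularOfDegree.exists_unit_flow {V : Type*} [Fintype V]
    {G : SimpleGraph V} [DecidableRel G.Adj] {k : ℕ} (hG : G.IsRegularOfDegree (2 * k)) :
    ∃ f : V → V → ℤ, (∀ u v, f u v = -f v u) ∧ (∀ u v, ¬ G.Adj u v → f u v = 0) ∧
      (∀ u v, G.Adj u v → f u v = 1 ∨ f u v = -1) ∧ ∀ u, ∑ v, f u v = 0 := by
  classical
  obtain ⟨φ, hφ, hmem⟩ := hG.exists_injective_edge_endpoint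
  let out (u v : V) : Prop := ∃ h : G.Adj u v, (φ ⟨s(u, v), h⟩).1 = u
  have out_swap {u v : V} (h : G.Adj u v) : out v u ↔ ¬ out u v := by
    have e : (⟨s(v, u), h.symm⟩ : G.edgeSet) = ⟨s(u, v), h⟩ := Subtype.ext Sym2.eq_swap
    have hm : (φ ⟨s(u, v), h⟩).1 = u ∨ (φ ⟨s(u, v), h⟩).1 = v := Sym2.mem_iff.1 (hmem ⟨s(u, v), h⟩)
    simp only [out, h, h.symm, exists_true_left, e]
    rcases hm with hm | hm <;> simp [hm, h.ne, h.ne']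
  have card_out (u : V) : #{v | out u v} ≤ k := by
    have hlab : Set.InjOn (fun v => if h : G.Adj u v then some (φ ⟨s(u, v), h⟩).2 else none)
        ({v | out u v} : Finset V) := by
      intro v hv w hw hvw
      obtain ⟨hv, hv'⟩ := (mem_filter.1 hv).2
      obtain ⟨hw, hw'⟩ := (mem_filter.1 hw).2
      simp only [hv, hw, dif_pos, Option.some.injEq] at hvw
      have := congrArg Subtype.val (hφ (Prod.ext (hv'.trans hw'.symm) hvw))
      exact Sym2.congr_right.1 this
    calc #{v | out u v} ≤ #((univ : Finset (Fin k)).map Function.Embedding.some) := by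
          refine card_le_card_of_injOn _ (fun v hv => ?_) hlab
          obtain ⟨hv, -⟩ := (mem_filter.1 hv).2
          simp [hv]
      _ = k := by simp
  let f (u v : V) : ℤ := if G.Adj u v then (if out u v then 1 else -1) else 0
  have anti (u v : V) : f u v = -f v u := by
    by_cases h : G.Adj u v
    · by_cases ho : out u v <;> simp [f, h, h.symm, out_swap h, ho]
    · simp [f, h, G.adj_comm v u]
  have excess (u : V) : ∑ v, f u v = 2 * #{v | out u v} - 2 * k := by
    have hf (v : V) : f u v = 2 * (if out u v then 1 else 0) - (if G.Adj u v then 1 else 0) := by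
      by_cases h : G.Adj u v
      · by_cases ho : out u v <;> simp [f, h, ho]
      · have : ¬ out u v := fun ho => h ho.1
        simp [f, h, this]
    have hdeg : #{v | G.Adj u v} = 2 * k := by
      rw [← hG u, ← G.card_neighborFinset_eq_degree, G.neighborFinset_eq_filter]
    simp only [hf, sum_sub_distrib, ← mul_sum, sum_boole, hdeg]
    push_cast
    rw [sum_boole]
  have total : ∑ u, ∑ v, f u v = 0 := by
    have : ∑ u, ∑ v, f u v = -∑ u, ∑ v, f u v := by
      conv_lhs => rw [sum_comm]
      simp only [← sum_neg_distrib, ← anti]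
    linarith
  refine ⟨f, anti, fun u v h => by simp [f, h], fun u v h => ?_, fun u => ?_⟩
  · by_cases ho : out u v <;> simp [f, h, ho]
  · refine (sum_eq_zero_iff_of_nonpos fun u _ => ?_).1 total u (mem_univ u)
    rw [excess]
    have := card_out u
    omega

open Finset in
/-- A finite cubic bipartite graph admits a flow with values `±1`, `±2` on its edges. -/
theorem SimpleGraph.IsRegularOfDegree.hasNowhereZero3Flow_of_bipartite {V : Type*} [Fintype V]
    {H : SimpleGraph V} [DecidableRel H.Adj] (hH : H.IsRegularOfDegree 3)
    (hbip : ∃ s : Set V, ∀ u v, H.Adj u v → (u ∈ s ↔ v ∉ s)) :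
    HasNowhereZero3Flow H := by
  classical
  obtain ⟨s, hs⟩ := hbip
  obtain ⟨m, hm, hadj⟩ := hH.exists_injective_adj (by norm_num)
  have hdeg (u : V) : #{v | H.Adj u v} = 3 := by
    rw [← hH u, ← H.card_neighborFinset_eq_degree, H.neighborFinset_eq_filter]
  let f (u v : V) : ℤ := if H.Adj u v then
    (if u ∈ s then (if m u = v then 2 else -1) else (if m v = u then -2 else 1)) else 0
  refine ⟨f, fun u v => ?_, fun u v h => by simp [f, h], fun u v h => ?_, fun u => ?_⟩
  · by_cases h : H.Adj u v
    · have := hs u v h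
      by_cases hv : v ∈ s
      · have hu : u ∉ s := fun hu => this.1 hu hv
        simp only [f, h, h.symm, hu, hv, if_true, if_false]
        split_ifs <;> rfl
      · have hu : u ∈ s := this.2 hv
        simp only [f, h, h.symm, hu, hv, if_true, if_false]
        split_ifs <;> rfl
    · simp [f, h, H.adj_comm v u]
  · simp only [f, h]
    split_ifs <;> simp_all
  · by_cases hu : u ∈ s
    · have hf (v : V) : f u v = 3 * (if m u = v then 1 else 0) - (if H.Adj u v then 1 else 0) := by
        by_cases hv : m u = v
        · simp [f, hu, ← hv, hadj]
        · by_cases h : H.Adj u v <;> simp [f, hu, h, hv]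
      simp only [hf, sum_sub_distrib, ← mul_sum, sum_ite_eq, sum_boole, hdeg]
      simp
    · obtain ⟨w, rfl⟩ := (Finite.injective_iff_surjective.1 hm) u
      have hf (v : V) : f (m w) v =
          (if H.Adj (m w) v then 1 else 0) - 3 * (if w = v then 1 else 0) := by
        by_cases hv : w = v
        · simp [f, hu, ← hv, (hadj w).symm]
        · by_cases h : H.Adj (m w) v <;> simp [f, hu, h, hv, hm.eq_iff, Ne.symm hv]
      simp only [hf, sum_sub_distrib, ← mul_sum, sum_ite_eq, sum_boole, hdeg]
      simp

/-- A regular graph of odd valency having a cubic bipartite spanning subgraph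
admits a nowhere-zero 3-flow. -/
theorem cubic_bipartite_spanning_subgraph_nowhere_zero_3_flow {V : Type*} [Fintype V]
    (Γ H : SimpleGraph V) [DecidableRel Γ.Adj] [DecidableRel H.Adj]
    (d : ℕ) (hd : Odd d)
    (hreg : Γ.IsRegularOfDegree d)
    (hsub : H ≤ Γ)
    (hcubic : H.IsRegularOfDegree 3)
    (hbip : ∃ s : Set V, ∀ u v, H.Adj u v → (u ∈ s ↔ v ∉ s)) :
    HasNowhereZero3Flow Γ := by
  classical
  have hdiff : (Γ \ H).IsRegularOfDegree (2 * ((d - 3) / 2)) := by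
    intro u
    have hN : (Γ \ H).neighborFinset u = Γ.neighborFinset u \ H.neighborFinset u := by
      ext v
      simp
    have hNsub : H.neighborFinset u ⊆ Γ.neighborFinset u := fun v hv => by
      simpa using hsub (by simpa using hv)
    rw [← SimpleGraph.card_neighborFinset_eq_degree, hN, Finset.card_sdiff_of_subset hNsub,
      SimpleGraph.card_neighborFinset_eq_degree, SimpleGraph.card_neighborFinset_eq_degree,
      hreg u, hcubic u]
    obtain ⟨n, rfl⟩ := hd
    omega
  obtain ⟨g, g_anti, g_zero, g_unit, g_sum⟩ := hdiff.exists_unit_flow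
  obtain ⟨f, f_anti, f_zero, f_bound, f_sum⟩ := hcubic.hasNowhereZero3Flow_of_bipartite hbip
  refine ⟨fun u v => f u v + g u v, fun u v => ?_, fun u v h => ?_, fun u v h => ?_, fun u => ?_⟩
  · linarith [f_anti u v, g_anti u v]
  · simp [f_zero u v fun h' => h (hsub h'), g_zero u v fun h' => h h'.1]
  · by_cases hH : H.Adj u v
    · simpa [g_zero u v fun h' => h'.2 hH] using f_bound u v hH
    · rcases g_unit u v ⟨h, hH⟩ with hg | hg <;> simp [f_zero u v hH, hg]
  · rw [Finset.sum_add_distrib, f_sum, g_sum, add_zero]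
end

section
/- For every integer n ≥ 2, the ladder graph L_n, defined as the Cartesian (box) product of a path on n vertices with the complete graph K₂ on two vertices, admits a nowhere-zero 3-flow. -/
/-- The ladder graph `L_n`: the Cartesian (box) product of a path on `n` vertices
with the complete graph on two vertices. -/
def ladder (n : ℕ) : SimpleGraph (Fin n × Fin 2) :=
  (SimpleGraph.pathGraph n).boxProd (⊤ : SimpleGraph (Fin 2))

/-- Flow along the rail edge from position `i - 1` to position `i`: it alternates between `1` and
`2` inside the ladder and vanishes outside. -/
def railFlow (n i : ℕ) : ℤ :=
  if i = 0 ∨ n ≤ i then 0 else if Even i then 2 else 1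

/-- A flow on the ladder: `railFlow` along one rail, its negative along the other, and on the rungs
the differences that make it conservative. -/
def ladderFlow (n : ℕ) (u v : Fin n × Fin 2) : ℤ :=
  (if u.2 = 0 then 1 else -1) *
    if u.2 = v.2 then
      (if (v.1 : ℕ) = u.1 + 1 then railFlow n (u.1 + 1) else 0) -
        (if (u.1 : ℕ) = v.1 + 1 then railFlow n u.1 else 0)
    else if u.1 = v.1 then railFlow n u.1 - railFlow n (u.1 + 1) else 0

theorem railFlow_zero (n : ℕ) : railFlow n 0 = 0 := by simp [railFlow]

theorem railFlow_of_le {n i : ℕ} (h : n ≤ i) : railFlow n i = 0 := by simp [railFlow, h]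

theorem railFlow_pos_and_lt {n i : ℕ} (h0 : i ≠ 0) (hn : i < n) :
    0 < railFlow n i ∧ railFlow n i < 3 := by
  unfold railFlow
  split_ifs <;> omega

theorem abs_railFlow_sub_succ {n i : ℕ} (hn : 2 ≤ n) (hi : i < n) :
    0 < |railFlow n i - railFlow n (i + 1)| ∧ |railFlow n i - railFlow n (i + 1)| < 3 := by
  unfold railFlow
  simp only [Nat.even_iff, Nat.add_eq_zero_iff, one_ne_zero, and_false, false_or]
  split_ifs <;> first | omega | norm_num

theorem ladder_adj {n : ℕ} {u v : Fin n × Fin 2} :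
    (ladder n).Adj u v ↔
      ((u.1 : ℕ) + 1 = v.1 ∨ (v.1 : ℕ) + 1 = u.1) ∧ u.2 = v.2 ∨ u.2 ≠ v.2 ∧ u.1 = v.1 := by
  simp [ladder, SimpleGraph.boxProd_adj, SimpleGraph.pathGraph_adj]

theorem sum_ite_val_eq_succ (n i : ℕ) :
    ∑ j : Fin n, (if (j : ℕ) = i + 1 then railFlow n (i + 1) else 0) = railFlow n (i + 1) := by
  rw [Fin.sum_univ_eq_sum_range (fun j => if j = i + 1 then railFlow n (i + 1) else 0),
    Finset.sum_ite_eq']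
  simp only [Finset.mem_range, ite_eq_left_iff, not_lt]
  exact fun h => (railFlow_of_le h).symm

theorem sum_ite_eq_val_succ {n i : ℕ} (hi : i < n) :
    ∑ j : Fin n, (if i = (j : ℕ) + 1 then railFlow n i else 0) = railFlow n i := by
  rw [Fin.sum_univ_eq_sum_range (fun j => if i = j + 1 then railFlow n i else 0)]
  cases i with
  | zero => simp [railFlow_zero]
  | succ k =>
    simp only [Nat.add_right_cancel_iff, Finset.sum_ite_eq, Finset.mem_range]
    rw [if_pos (by omega)]

theorem ladderFlow_antisymm (n : ℕ) (u v : Fin n × Fin 2) :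
    ladderFlow n u v = -ladderFlow n v u := by
  obtain ⟨i, a⟩ := u
  obtain ⟨j, b⟩ := v
  simp only [ladderFlow]
  fin_cases a <;> fin_cases b <;> simp <;> grind

theorem ladderFlow_eq_zero {n : ℕ} {u v : Fin n × Fin 2} (h : ¬ (ladder n).Adj u v) :
    ladderFlow n u v = 0 := by
  rw [ladder_adj] at h
  unfold ladderFlow
  grind

theorem abs_ladderFlow {n : ℕ} (hn : 2 ≤ n) {u v : Fin n × Fin 2} (h : (ladder n).Adj u v) :
    0 < |ladderFlow n u v| ∧ |ladderFlow n u v| < 3 := by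
  have hsign : |(if u.2 = 0 then 1 else -1 : ℤ)| = 1 := by split_ifs <;> rfl
  rw [ladderFlow, abs_mul, hsign, one_mul]
  rcases ladder_adj.1 h with ⟨huv | hvu, hab⟩ | ⟨hab, huv⟩
  · have hr := railFlow_pos_and_lt (n := n) (i := u.1 + 1) (by omega) (by omega)
    rw [if_pos hab, if_pos huv.symm, if_neg (by omega), sub_zero, abs_of_pos hr.1]
    exact hr
  · have hr := railFlow_pos_and_lt (n := n) (i := u.1) (by omega) u.1.isLt
    rw [if_pos hab, if_neg (by omega), if_pos hvu.symm, zero_sub, abs_neg, abs_of_pos hr.1]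
    exact hr
  · rw [if_neg hab, if_pos huv]
    exact abs_railFlow_sub_succ hn u.1.isLt

theorem sum_ladderFlow (n : ℕ) (u : Fin n × Fin 2) : ∑ v, ladderFlow n u v = 0 := by
  obtain ⟨i, a⟩ := u
  simp only [ladderFlow, ← Finset.mul_sum]
  rw [Fintype.sum_prod_type]
  fin_cases a <;>
    simp [Finset.sum_add_distrib, Finset.sum_sub_distrib, sum_ite_val_eq_succ,
      sum_ite_eq_val_succ i.isLt]

/-- For every `n ≥ 2`, the ladder graph `L_n` admits a nowhere-zero 3-flow. -/
theorem ladder_nowhere_zero_3_flow (n : ℕ) (hn : 2 ≤ n) :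
    HasNowhereZero3Flow (ladder n) := by
  exact ⟨ladderFlow n, ladderFlow_antisymm n, fun _ _ => ladderFlow_eq_zero,
    fun _ _ => abs_ladderFlow hn, sum_ladderFlow n⟩
end

section
/- For every integer n ≥ 3, the circular ladder CL_n admits a nowhere-zero 3-flow if and only if n is even. -/
/-- The circular ladder `CL_n` on vertex set `ZMod n × ZMod 2`: `(i,ε)` and `(j,δ)`
are adjacent iff `ε = δ` and `j = i ± 1`, or `i = j` and `ε ≠ δ`. -/
def circularLadder (n : ℕ) : SimpleGraph (ZMod n × ZMod 2) :=
  SimpleGraph.fromRel (fun p q => (p.2 = q.2 ∧ q.1 = p.1 + 1) ∨ (p.1 = q.1 ∧ p.2 ≠ q.2))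

theorem ZMod.two_ne_zero_of_three_le {n : ℕ} (hn : 3 ≤ n) : (2 : ZMod n) ≠ 0 := by
  intro h
  have h' : ((2 : ℕ) : ZMod n) = 0 := by exact_mod_cast h
  rw [ZMod.natCast_eq_zero_iff] at h'
  have := Nat.le_of_dvd (by norm_num) h'
  omega

theorem ZMod.one_ne_zero_of_three_le {n : ℕ} (hn : 3 ≤ n) : (1 : ZMod n) ≠ 0 := by
  intro h
  exact ZMod.two_ne_zero_of_three_le hn (by rw [← one_add_one_eq_two, h, add_zero])

theorem ZMod.two_ne_iff_eq_add_one (a b : ZMod 2) : a ≠ b ↔ b = a + 1 := by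
  revert a b
  decide

theorem circularLadder_adj_iff {n : ℕ} (hn : 3 ≤ n) (i j : ZMod n) (ε δ : ZMod 2) :
    (circularLadder n).Adj (i, ε) (j, δ) ↔
      (j, δ) = (i + 1, ε) ∨ (j, δ) = (i - 1, ε) ∨ (j, δ) = (i, ε + 1) := by
  have h1 := ZMod.one_ne_zero_of_three_le hn
  simp only [circularLadder, SimpleGraph.fromRel_adj, Prod.mk.injEq, ne_eq]
  rw [← ne_eq ε δ, ← ne_eq δ ε, ne_comm (a := δ), ZMod.two_ne_iff_eq_add_one]
  constructor
  · rintro ⟨-, (⟨rfl, rfl⟩ | ⟨rfl, rfl⟩) | (⟨rfl, rfl⟩ | ⟨rfl, rfl⟩)⟩ <;> simp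
  · rintro (⟨rfl, rfl⟩ | ⟨rfl, rfl⟩ | ⟨rfl, rfl⟩) <;> simp [h1, eq_sub_iff_add_eq]

/-- A function supported on the neighbours of a vertex sums to its values on the three of them. -/
theorem sum_eq_of_circularLadder_support {n : ℕ} [NeZero n] (hn : 3 ≤ n) (i : ZMod n)
    (ε : ZMod 2) (g : ZMod n × ZMod 2 → ℤ)
    (hg : ∀ v, ¬ (circularLadder n).Adj (i, ε) v → g v = 0) :
    ∑ v, g v = g (i + 1, ε) + g (i - 1, ε) + g (i, ε + 1) := by
  have h2 := ZMod.two_ne_zero_of_three_le hn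
  have hpm : i + 1 ≠ i - 1 := by
    intro h
    apply h2
    linear_combination h
  have hsub : ∑ v, g v = ∑ v ∈ {(i + 1, ε), (i - 1, ε), (i, ε + 1)}, g v := by
    symm
    apply Finset.sum_subset (Finset.subset_univ _)
    rintro ⟨j, δ⟩ - hv
    apply hg
    rw [circularLadder_adj_iff hn]
    simpa using hv
  rw [hsub, Finset.sum_insert (by simp [hpm]), Finset.sum_insert (by simp),
    Finset.sum_singleton, add_assoc]

/-- In a nowhere-zero 3-flow, consecutive rail values are opposite modulo 3. -/
theorem even_of_circularLadder_hasNowhereZero3Flow {n : ℕ} [NeZero n] (hn : 3 ≤ n)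
    (h : HasNowhereZero3Flow (circularLadder n)) : Even n := by
  obtain ⟨f, hanti, hsupp, hbound, hsum⟩ := h
  set g : ZMod n → ℤ := fun i => f (i, 0) (i + 1, 0) with hg
  have hb (i : ZMod n) : 0 < |g i| ∧ |g i| < 3 :=
    hbound _ _ ((circularLadder_adj_iff hn _ _ _ _).2 (Or.inl rfl))
  have hstep (i : ZMod n) : (3 : ℤ) ∣ g (i + 1) + g i := by
    have hs := hsum (i + 1, 0)
    rw [sum_eq_of_circularLadder_support hn _ _ _ (hsupp _)] at hs
    have hr := hbound (i + 1, 0) (i + 1, 0 + 1)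
      ((circularLadder_adj_iff hn _ _ _ _).2 (Or.inr (Or.inr rfl)))
    have h0 := hb i
    have h1 := hb (i + 1)
    rw [add_sub_cancel_right, hanti (i + 1, 0) (i, 0)] at hs
    simp only [hg, abs_pos, abs_lt] at *
    have hval : f (i, 0) (i + 1, 0) = -2 ∨ f (i, 0) (i + 1, 0) = -1 ∨
        f (i, 0) (i + 1, 0) = 1 ∨ f (i, 0) (i + 1, 0) = 2 := by omega
    rcases hval with hval | hval | hval | hval <;> omega
  have hpow (k : ℕ) : (3 : ℤ) ∣ g k - (-1) ^ k * g 0 := by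
    induction k with
    | zero => simp
    | succ k ih =>
      have hk := dvd_sub (hstep k) ih
      rw [Nat.cast_succ, pow_succ]
      rwa [show g (k + 1) - (-1) ^ k * -1 * g 0 = g (k + 1) + g k - (g k - (-1) ^ k * g 0) by ring]
  by_contra hodd
  have hlast := hpow n
  rw [ZMod.natCast_self, (Nat.not_even_iff_odd.1 hodd).neg_one_pow] at hlast
  have h0 := hb 0
  rw [abs_pos, abs_lt] at h0
  omega

/-- The sign of a vertex in the bipartition of an even circular ladder. -/
def circularLadderSign {n : ℕ} (h : 2 ∣ n) (p : ZMod n × ZMod 2) : ℤ :=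
  if ZMod.castHom h (ZMod 2) p.1 + p.2 = 0 then 1 else -1

theorem ite_add_one_eq_zero_eq_neg (a : ZMod 2) :
    (if a + 1 = 0 then 1 else -1 : ℤ) = -(if a = 0 then 1 else -1) := by
  revert a
  decide

theorem circularLadderSign_rail {n : ℕ} (h : 2 ∣ n) (i : ZMod n) (ε : ZMod 2) :
    circularLadderSign h (i + 1, ε) = -circularLadderSign h (i, ε) := by
  simp only [circularLadderSign, map_add, map_one]
  rw [add_right_comm, ite_add_one_eq_zero_eq_neg]

theorem circularLadderSign_rung {n : ℕ} (h : 2 ∣ n) (i : ZMod n) (ε : ZMod 2) :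
    circularLadderSign h (i, ε + 1) = -circularLadderSign h (i, ε) := by
  simp only [circularLadderSign]
  rw [← add_assoc, ite_add_one_eq_zero_eq_neg]

theorem circularLadderSign_of_adj {n : ℕ} (hn : 3 ≤ n) (h : 2 ∣ n) {u v : ZMod n × ZMod 2}
    (huv : (circularLadder n).Adj u v) :
    circularLadderSign h u = -circularLadderSign h v := by
  obtain ⟨i, ε⟩ := u
  obtain ⟨j, δ⟩ := v
  rcases (circularLadder_adj_iff hn _ _ _ _).1 huv with hv | hv | hv <;> rw [hv]
  · rw [circularLadderSign_rail, neg_neg]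
  · rw [← circularLadderSign_rail, sub_add_cancel]
  · rw [circularLadderSign_rung, neg_neg]

theorem circularLadderSign_eq_one_or {n : ℕ} (h : 2 ∣ n) (p : ZMod n × ZMod 2) :
    circularLadderSign h p = 1 ∨ circularLadderSign h p = -1 := by
  unfold circularLadderSign
  split_ifs <;> simp

open Classical in
/-- Rungs carry two units from the positive to the negative side of the bipartition, and rail
edges carry one unit back. -/
theorem circularLadder_hasNowhereZero3Flow_of_even {n : ℕ} [NeZero n] (hn : 3 ≤ n)
    (h : Even n) : HasNowhereZero3Flow (circularLadder n) := by
  have h2 := h.two_dvd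
  refine ⟨fun u v => if (circularLadder n).Adj u v then
    circularLadderSign h2 u * (if u.2 = v.2 then -1 else 2) else 0, ?_, ?_, ?_, ?_⟩
  · intro u v
    by_cases huv : (circularLadder n).Adj u v
    · simp only [huv, huv.symm, if_true, eq_comm (a := v.2),
        circularLadderSign_of_adj hn h2 huv, neg_mul]
    · simp [huv, mt SimpleGraph.Adj.symm huv]
  · intro u v huv
    simp [huv]
  · intro u v huv
    simp only [huv, if_true]
    rcases circularLadderSign_eq_one_or h2 u with hs | hs <;> rw [hs] <;> split_ifs <;> norm_num
  · rintro ⟨i, ε⟩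
    rw [sum_eq_of_circularLadder_support hn i ε _ (fun v hv => by simp [hv])]
    simp only [circularLadder_adj_iff hn, true_or, or_true, if_true]
    rw [if_neg (show ε ≠ ε + 1 by simp)]
    ring

/-- For `n ≥ 3`, the circular ladder `CL_n` admits a nowhere-zero 3-flow
iff `n` is even. -/
theorem circularLadder_nowhere_zero_3_flow_iff (n : ℕ) [NeZero n] (hn : 3 ≤ n) :
    HasNowhereZero3Flow (circularLadder n) ↔ Even n :=
  ⟨even_of_circularLadder_hasNowhereZero3Flow hn, circularLadder_hasNowhereZero3Flow_of_even hn⟩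
end

section
/- For every integer n ≥ 2, the Möbius ladder M_n admits a nowhere-zero 3-flow if and only if n is odd. -/
/-- The Möbius ladder `M_n` on vertex set `ZMod (2n)`: `i` and `j` are adjacent
iff `j = i ± 1` or `j = i + n`. -/
def mobiusLadder (n : ℕ) : SimpleGraph (ZMod (2 * n)) :=
  SimpleGraph.fromRel (fun i j => j = i + 1 ∨ j = i + (n : ZMod (2 * n)))

theorem natCast_add_self_zmod_two_mul (n : ℕ) : (n : ZMod (2 * n)) + n = 0 := by
  have h := ZMod.natCast_self (2 * n)
  push_cast at h
  linear_combination h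

theorem natCast_zmod_ne_zero {m k : ℕ} (hk : 0 < k) (hkm : k < m) : (k : ZMod m) ≠ 0 := by
  rw [Ne, ZMod.natCast_eq_zero_iff]
  exact Nat.not_dvd_of_pos_of_lt hk hkm

theorem one_ne_neg_one_zmod_two_mul {n : ℕ} (hn : 2 ≤ n) : (1 : ZMod (2 * n)) ≠ -1 := by
  intro h
  refine natCast_zmod_ne_zero (m := 2 * n) (k := 2) (by omega) (by omega) ?_
  push_cast
  linear_combination h

theorem one_ne_natCast_zmod_two_mul {n : ℕ} (hn : 2 ≤ n) : (1 : ZMod (2 * n)) ≠ n := by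
  intro h
  refine natCast_zmod_ne_zero (m := 2 * n) (k := n + 1) (by omega) (by omega) ?_
  push_cast
  linear_combination h + natCast_add_self_zmod_two_mul n

theorem neg_one_ne_natCast_zmod_two_mul {n : ℕ} (hn : 2 ≤ n) : (-1 : ZMod (2 * n)) ≠ n := by
  intro h
  refine natCast_zmod_ne_zero (m := 2 * n) (k := n + 1) (by omega) (by omega) ?_
  push_cast
  linear_combination -h

theorem mobiusLadder_adj_iff {n : ℕ} (hn : 2 ≤ n) (u v : ZMod (2 * n)) :
    (mobiusLadder n).Adj u v ↔ v - u = 1 ∨ v - u = -1 ∨ v - u = n := by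
  have hnn := natCast_add_self_zmod_two_mul n
  have h1 := natCast_zmod_ne_zero (m := 2 * n) (k := 1) (by omega) (by omega)
  have h2 := natCast_zmod_ne_zero (m := 2 * n) (k := n) (by omega) (by omega)
  rw [Nat.cast_one] at h1
  rw [mobiusLadder, SimpleGraph.fromRel_adj]
  constructor
  · rintro ⟨-, (h | h) | (h | h)⟩
    · left; linear_combination h
    · right; right; linear_combination h
    · right; left; linear_combination -h
    · right; right; linear_combination -h - hnn
  · rintro (h | h | h)
    · refine ⟨fun e => h1 ?_, Or.inl (Or.inl ?_)⟩
      · rw [← h, e, sub_self]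
      · linear_combination h
    · refine ⟨fun e => h1 ?_, Or.inr (Or.inl ?_)⟩
      · rw [← neg_neg (1 : ZMod (2 * n)), ← h, e, sub_self, neg_zero]
      · linear_combination -h
    · refine ⟨fun e => h2 ?_, Or.inl (Or.inr ?_)⟩
      · rw [← h, e, sub_self]
      · linear_combination h

theorem sum_eq_of_mobiusLadder_support {n : ℕ} [NeZero n] (hn : 2 ≤ n) (u : ZMod (2 * n))
    (g : ZMod (2 * n) → ℤ) (hg : ∀ v, ¬ (mobiusLadder n).Adj u v → g v = 0) :
    ∑ v, g v = g (u + 1) + g (u - 1) + g (u + n) := by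
  have h1 := one_ne_neg_one_zmod_two_mul hn
  have h2 := one_ne_natCast_zmod_two_mul hn
  have h3 := neg_one_ne_natCast_zmod_two_mul hn
  rw [← Finset.sum_subset (Finset.subset_univ {u + 1, u - 1, u + (n : ZMod (2 * n))})]
  · rw [sub_eq_add_neg, Finset.sum_insert, Finset.sum_pair, add_assoc]
    · simpa using h3
    · simp [h1, h2]
  · intro v _ hv
    refine hg v fun h => hv ?_
    simp only [Finset.mem_insert, Finset.mem_singleton]
    rcases (mobiusLadder_adj_iff hn u v).1 h with h | h | h
    · left; linear_combination h
    · right; left; linear_combination h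
    · right; right; linear_combination h

/-- The parity sign on `ZMod (2n)`. -/
def paritySign (n : ℕ) (u : ZMod (2 * n)) : ℤ :=
  if ZMod.castHom (dvd_mul_right 2 n) (ZMod 2) u = 0 then 1 else -1

theorem paritySign_add_of_odd {n : ℕ} (u d : ZMod (2 * n))
    (hd : ZMod.castHom (dvd_mul_right 2 n) (ZMod 2) d = 1) :
    paritySign n (u + d) = - paritySign n u := by
  unfold paritySign
  rw [map_add, hd]
  generalize ZMod.castHom (dvd_mul_right 2 n) (ZMod 2) u = x
  revert x
  decide

theorem paritySign_eq (n : ℕ) (u : ZMod (2 * n)) : paritySign n u = 1 ∨ paritySign n u = -1 := by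
  unfold paritySign
  split_ifs <;> simp

/-- The signed edge weight `s(u) w(v - u)`, with `w = 1` on rails and `w = -2` on rungs. -/
def mobiusLadderFlow (n : ℕ) (u v : ZMod (2 * n)) : ℤ :=
  paritySign n u * if v - u = 1 ∨ v - u = -1 then 1 else if v - u = n then -2 else 0

theorem hasNowhereZero3Flow_mobiusLadder_of_odd {n : ℕ} [NeZero n] (hn : 2 ≤ n) (hodd : Odd n) :
    HasNowhereZero3Flow (mobiusLadder n) := by
  have hzero : ∀ u v, ¬ (mobiusLadder n).Adj u v → mobiusLadderFlow n u v = 0 := by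
    intro u v h
    rw [mobiusLadder_adj_iff hn] at h
    simp_all [mobiusLadderFlow]
  have h2 := one_ne_natCast_zmod_two_mul hn
  have h3 := neg_one_ne_natCast_zmod_two_mul hn
  have hnn : -(n : ZMod (2 * n)) = n := by
    linear_combination -natCast_add_self_zmod_two_mul n
  refine ⟨mobiusLadderFlow n, fun u v => ?_, hzero, fun u v h => ?_, fun u => ?_⟩
  · by_cases h : (mobiusLadder n).Adj u v
    · have hs : paritySign n v = - paritySign n u := by
        rw [← add_sub_cancel u v]
        apply paritySign_add_of_odd
        rcases (mobiusLadder_adj_iff hn u v).1 h with h | h | h <;> rw [h]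
        · exact map_one _
        · rw [map_neg, map_one]; decide
        · rw [map_natCast, ZMod.natCast_eq_one_iff_odd.2 hodd]
      have hw : ∀ d : ZMod (2 * n), v - u = -d ↔ u - v = d := fun d =>
        ⟨fun e => by linear_combination -e, fun e => by linear_combination -e⟩
      have e1 := hw 1
      have e2 := hw (-1)
      have e3 := hw n
      rw [neg_neg] at e2
      rw [hnn] at e3
      simp only [mobiusLadderFlow, hs, e1, e2, e3, or_comm (a := u - v = -1)]
      ring
    · rw [hzero u v h, hzero v u fun h' => h h'.symm, neg_zero]
  · rw [mobiusLadder_adj_iff hn] at h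
    rcases paritySign_eq n u with hs | hs <;> rcases h with h | h | h <;>
      simp [mobiusLadderFlow, hs, h, h2.symm, h3.symm]
  · rw [sum_eq_of_mobiusLadder_support hn u _ (hzero u)]
    simp only [mobiusLadderFlow, add_sub_cancel_left, sub_sub_cancel_left, h2.symm, h3.symm,
      true_or, or_true, or_self, if_true, if_false]
    ring

theorem emod_three_eq_of_flow {a b c : ℤ} (ha : 0 < |a| ∧ |a| < 3) (hb : 0 < |b| ∧ |b| < 3)
    (hc : 0 < |c| ∧ |c| < 3) (h : a + b + c = 0) : a % 3 = b % 3 ∧ a % 3 = c % 3 := by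
  simp only [abs_pos, abs_lt] at ha hb hc
  omega

theorem odd_of_hasNowhereZero3Flow_mobiusLadder {n : ℕ} [NeZero n] (hn : 2 ≤ n)
    (h : HasNowhereZero3Flow (mobiusLadder n)) : Odd n := by
  obtain ⟨f, hanti, hzero, hbound, hsum⟩ := h
  have hadj := mobiusLadder_adj_iff hn
  have key : ∀ u, f u (u + 1) % 3 = f u (u - 1) % 3 ∧ f u (u + 1) % 3 = f u (u + n) % 3 := by
    intro u
    refine emod_three_eq_of_flow (hbound _ _ ?_) (hbound _ _ ?_) (hbound _ _ ?_) ?_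
    · simp [hadj]
    · simp [hadj]
    · simp [hadj]
    · rw [← sum_eq_of_mobiusLadder_support hn u (f u) (hzero u), hsum]
  have hrail : ∀ u, f (u + 1) (u + 1 + 1) % 3 = (-f u (u + 1)) % 3 := by
    intro u
    rw [(key (u + 1)).1, add_sub_cancel_right, hanti]
  have hrung : ∀ u, f (u + n) (u + n + 1) % 3 = (-f u (u + 1)) % 3 := by
    intro u
    have e : u + (n : ZMod (2 * n)) + n = u := by
      linear_combination natCast_add_self_zmod_two_mul n
    have k1 := (key (u + n)).2
    have k2 := (key u).2
    rw [e, hanti (u + n) u] at k1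
    omega
  have heven : ∀ k : ℕ, f ((k + k : ℕ) : ZMod (2 * n)) ((k + k : ℕ) + 1) % 3 = f 0 (0 + 1) % 3 := by
    intro k
    induction k with
    | zero => simp
    | succ k ih =>
      have r1 := hrail ((k + k : ℕ) : ZMod (2 * n))
      have r2 := hrail (((k + k : ℕ) : ZMod (2 * n)) + 1)
      have e : ((k + 1 + (k + 1) : ℕ) : ZMod (2 * n)) = ((k + k : ℕ) : ZMod (2 * n)) + 1 + 1 := by
        push_cast; ring
      rw [e]
      omega
  by_contra hodd
  obtain ⟨k, hk⟩ := Nat.not_odd_iff_even.1 hodd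
  have h1 := heven k
  have h2 := hrung 0
  rw [← hk] at h1
  rw [zero_add (n : ZMod (2 * n))] at h2
  have h3 := hbound 0 (0 + 1) (by simp [hadj])
  rw [abs_pos, abs_lt] at h3
  omega

/-- For `n ≥ 2`, the Möbius ladder `M_n` admits a nowhere-zero 3-flow
iff `n` is odd. -/
theorem mobiusLadder_nowhere_zero_3_flow_iff (n : ℕ) [NeZero n] (hn : 2 ≤ n) :
    HasNowhereZero3Flow (mobiusLadder n) ↔ Odd n :=
  ⟨odd_of_hasNowhereZero3Flow_mobiusLadder hn, hasNowhereZero3Flow_mobiusLadder_of_odd hn⟩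
end
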